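/- Let P be a closed path polyomino containing both a W-pentomino and an RW-heptomino. Then there exists a subset Y ⊆ V(P) such that the set G of all inner 2-minors of P is the reduced Gröbner basis of the polyomino ideal I_P with respect to the monomial order <^Y_lex. -/

import Mathlib

namespace ClosedPathPaper

open MvPolynomial

/-- Lattice points of `ℤ²`; a cell is identified with its lower left corner. -/
abbrev Pt : Type := ℤ × ℤ

/-- The four vertices (corners) of the unit cell with lower left corner `a`. -/
def cellVerts (a : Pt) : Set Pt :=
  {a, (a.1 + 1, a.2), (a.1, a.2 + 1), (a.1 + 1, a.2 + 1)}

/-- The vertex set `V(P)` of a collection of cells `P`. -/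
def VP (P : Finset Pt) : Set Pt := ⋃ a ∈ P, cellVerts a

/-- `[a,b]` is a proper interval and every cell contained in it belongs to `P`. -/
def IsInnerInterval (P : Finset Pt) (a b : Pt) : Prop :=
  a.1 < b.1 ∧ a.2 < b.2 ∧
    ∀ c : Pt, a.1 ≤ c.1 → c.1 < b.1 → a.2 ≤ c.2 → c.2 < b.2 → c ∈ P

/-- The four corners of the proper interval `[a,b]`:
diagonal corners `a, b` and anti-diagonal corners `c = (a.1, b.2)`, `d = (b.1, a.2)`. -/
def cornersOf (a b : Pt) : Finset Pt := {a, b, (a.1, b.2), (b.1, a.2)}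

/-- The inner 2-minor `f_{a,b} = x_a x_b - x_c x_d` attached to the inner interval `[a,b]`. -/
noncomputable def innerMinor (K : Type*) [Field K] (a b : Pt) : MvPolynomial Pt K :=
  X a * X b - X (a.1, b.2) * X (b.1, a.2)

/-- The set `G` of all inner 2-minors of `P`. -/
def minorsSet (K : Type*) [Field K] (P : Finset Pt) : Set (MvPolynomial Pt K) :=
  {f | ∃ a b : Pt, IsInnerInterval P a b ∧ f = innerMinor K a b}

/-- The polyomino ideal `I_P`. -/
noncomputable def polyoIdeal (K : Type*) [Field K] (P : Finset Pt) :
    Ideal (MvPolynomial Pt K) :=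
  Ideal.span (minorsSet K P)

/-! ### Monomial orders -/

/-- Strict lexicographic comparison of exponent vectors induced by the
(strict total) order `po` on the variables. -/
def lexLt (po : Pt → Pt → Prop) (u v : Pt →₀ ℕ) : Prop :=
  ∃ w : Pt, u w < v w ∧ ∀ w' : Pt, po w w' → u w' = v w'

def lexLe (po : Pt → Pt → Prop) (u v : Pt →₀ ℕ) : Prop := u = v ∨ lexLt po u v

/-- `m` is the leading monomial of `f` with respect to the lexicographic order
induced by `po`. -/
def IsLM {K : Type*} [Field K] (po : Pt → Pt → Prop) (f : MvPolynomial Pt K)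
    (m : Pt →₀ ℕ) : Prop :=
  m ∈ f.support ∧ ∀ m' ∈ f.support, lexLe po m' m

/-- `sp` is the S-polynomial of `f` and `g` with respect to the lexicographic
order induced by `po`. -/
def IsSPoly {K : Type*} [Field K] (po : Pt → Pt → Prop) (f g sp : MvPolynomial Pt K) : Prop :=
  ∃ mf mg : Pt →₀ ℕ, IsLM po f mf ∧ IsLM po g mg ∧
    sp = monomial (mf ⊔ mg - mf) (f.coeff mf)⁻¹ * f
       - monomial (mf ⊔ mg - mg) (g.coeff mg)⁻¹ * g

/-- `h` has a standard expression with respect to `G`, i.e. `h` reduces to `0`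
modulo `G` with respect to the lexicographic order induced by `po`. -/
def ReducesToZero {K : Type*} [Field K] (po : Pt → Pt → Prop)
    (G : Set (MvPolynomial Pt K)) (h : MvPolynomial Pt K) : Prop :=
  ∃ (F : Finset (MvPolynomial Pt K)) (q : MvPolynomial Pt K → MvPolynomial Pt K),
    ↑F ⊆ G ∧ h = ∑ g ∈ F, q g * g ∧
    ∀ g ∈ F, ∀ m, IsLM po (q g * g) m → ∃ mh, IsLM po h mh ∧ lexLe po m mh

/-- The exponent vector of `x_u x_v x_w`. -/
noncomputable def mono3 (u v w : Pt) : Pt →₀ ℕ :=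
  Finsupp.single u 1 + Finsupp.single v 1 + Finsupp.single w 1

/-- The leading monomials, viewed as polynomials, of the members of `G`. -/
def leadingMonomials {K : Type*} [Field K] (po : Pt → Pt → Prop)
    (G : Set (MvPolynomial Pt K)) : Set (MvPolynomial Pt K) :=
  {f | ∃ g ∈ G, ∃ m, IsLM po g m ∧ f = monomial m (1 : K)}

/-- The initial ideal of `I` with respect to the lexicographic order induced by `po`. -/
noncomputable def initialIdeal {K : Type*} [Field K] (po : Pt → Pt → Prop)
    (I : Ideal (MvPolynomial Pt K)) : Ideal (MvPolynomial Pt K) :=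
  Ideal.span (leadingMonomials po (I : Set (MvPolynomial Pt K)))

/-- `G` is a Gröbner basis of `I`. -/
def IsGroebnerBasis {K : Type*} [Field K] (po : Pt → Pt → Prop)
    (G : Set (MvPolynomial Pt K)) (I : Ideal (MvPolynomial Pt K)) : Prop :=
  Ideal.span G = I ∧ Ideal.span (leadingMonomials po G) = initialIdeal po I

/-- `G` is the reduced Gröbner basis of `I` (up to normalizing signs). -/
def IsReducedGroebnerBasis {K : Type*} [Field K] (po : Pt → Pt → Prop)
    (G : Set (MvPolynomial Pt K)) (I : Ideal (MvPolynomial Pt K)) : Prop :=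
  IsGroebnerBasis po G I ∧
  (∀ g ∈ G, ∃ m, IsLM po g m ∧ (g.coeff m = 1 ∨ g.coeff m = -1)) ∧
  (∀ g ∈ G, ∀ g' ∈ G, g' ≠ g → ∀ m ∈ g.support, ∀ m', IsLM po g' m' → ¬ m' ≤ m)

/-! ### Closed paths and special configurations -/

/-- Two cells share a common edge. -/
def cellAdj (a b : Pt) : Prop :=
  b = (a.1 + 1, a.2) ∨ b = (a.1 - 1, a.2) ∨ b = (a.1, a.2 + 1) ∨ b = (a.1, a.2 - 1)

/-- `P` is a closed path polyomino. -/
def IsClosedPath (P : Finset Pt) : Prop :=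
  ∃ n : ℕ, 5 < n ∧ ∃ A : ZMod n → Pt,
    Function.Injective A ∧
    (∀ i, cellAdj (A i) (A (i + 1))) ∧
    (∀ i j : ZMod n, j ≠ i - 2 → j ≠ i - 1 → j ≠ i → j ≠ i + 1 → j ≠ i + 2 →
      cellVerts (A i) ∩ cellVerts (A j) = ∅) ∧
    ∀ c : Pt, c ∈ P ↔ ∃ i, A i = c

/-- The horizontal block of rank `m` whose leftmost cell is `a`. -/
def hBlockCells (a : Pt) (m : ℕ) : Finset Pt :=
  (Finset.range m).image fun t : ℕ => (a.1 + (t : ℤ), a.2)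

/-- The vertical block of rank `m` whose bottom cell is `a`. -/
def vBlockCells (a : Pt) (m : ℕ) : Finset Pt :=
  (Finset.range m).image fun t : ℕ => (a.1, a.2 + (t : ℤ))

/-- The vertex set of a finite set of cells. -/
def vertsOfCells (s : Finset Pt) : Set Pt := ⋃ c ∈ s, cellVerts c

/-- A W-pentomino of `P`: a horizontal block of rank two with leftmost cell `a₁`, a
vertical block of rank two with bottom cell `a₂`, and a middle cell `A` not belonging to the
two blocks, such that the vertex sets of the two blocks meet exactly in the lower right
corner of `A`. -/
def IsWPentomino (P : Finset Pt) (a₁ a₂ A : Pt) : Prop :=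
  hBlockCells a₁ 2 ⊆ P ∧ vBlockCells a₂ 2 ⊆ P ∧ A ∈ P ∧
  A ∉ hBlockCells a₁ 2 ∪ vBlockCells a₂ 2 ∧
  vertsOfCells (hBlockCells a₁ 2) ∩ vertsOfCells (vBlockCells a₂ 2) = {(A.1 + 1, A.2)}

/-- An RW-heptomino of `P`: a horizontal block of rank three with leftmost cell `a₁`, a
vertical block of rank three with bottom cell `a₂`, and a middle cell `A` not belonging to
the two blocks, such that the vertex sets of the two blocks meet exactly in the upper left
corner of `A`. -/
def IsRWHeptomino (P : Finset Pt) (a₁ a₂ A : Pt) : Prop :=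
  hBlockCells a₁ 3 ⊆ P ∧ vBlockCells a₂ 3 ⊆ P ∧ A ∈ P ∧
  A ∉ hBlockCells a₁ 3 ∪ vBlockCells a₂ 3 ∧
  vertsOfCells (hBlockCells a₁ 3) ∩ vertsOfCells (vBlockCells a₂ 3) = {(A.1, A.2 + 1)}

/-- An LD-horizontal skew tetromino of `P` (base point `p`): the cells
`p, p+(1,0), p+(1,1), p+(2,1)`. -/
def IsLDhTetromino (P : Finset Pt) (p : Pt) : Prop :=
  p ∈ P ∧ (p.1 + 1, p.2) ∈ P ∧ (p.1 + 1, p.2 + 1) ∈ P ∧ (p.1 + 2, p.2 + 1) ∈ P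

/-- An LD-vertical skew tetromino of `P` (base point `p`): the cells
`p, p+(0,1), p+(1,1), p+(1,2)`. -/
def IsLDvTetromino (P : Finset Pt) (p : Pt) : Prop :=
  p ∈ P ∧ (p.1, p.2 + 1) ∈ P ∧ (p.1 + 1, p.2 + 1) ∈ P ∧ (p.1 + 1, p.2 + 2) ∈ P

/-- An LD-horizontal skew hexomino of `P` (base point `p`): the cells
`p, p+(1,0), p+(2,0), p+(2,1), p+(3,1), p+(4,1)`. -/
def IsLDhHexomino (P : Finset Pt) (p : Pt) : Prop :=
  p ∈ P ∧ (p.1 + 1, p.2) ∈ P ∧ (p.1 + 2, p.2) ∈ P ∧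
  (p.1 + 2, p.2 + 1) ∈ P ∧ (p.1 + 3, p.2 + 1) ∈ P ∧ (p.1 + 4, p.2 + 1) ∈ P

/-- An LD-vertical skew hexomino of `P` (base point `p`): the cells
`p, p+(0,1), p+(0,2), p+(1,2), p+(1,3), p+(1,4)`. -/
def IsLDvHexomino (P : Finset Pt) (p : Pt) : Prop :=
  p ∈ P ∧ (p.1, p.2 + 1) ∈ P ∧ (p.1, p.2 + 2) ∈ P ∧
  (p.1 + 1, p.2 + 2) ∈ P ∧ (p.1 + 1, p.2 + 3) ∈ P ∧ (p.1 + 1, p.2 + 4) ∈ P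

/-- The total order `<¹` on `ℤ²`. -/
def lt1 (a b : Pt) : Prop := a.1 < b.1 ∨ (a.1 = b.1 ∧ a.2 < b.2)

/-- The P-order `<^Y` attached to a set `Y` of vertices. -/
def Ylt (Y : Set Pt) (a b : Pt) : Prop :=
  (a ∉ Y ∧ b ∈ Y) ∨ (a ∉ Y ∧ b ∉ Y ∧ lt1 a b) ∨ (a ∈ Y ∧ b ∈ Y ∧ lt1 a b)




def YD (N : ℤ → ℤ → ℤ → ℤ → Prop) (x y : ℤ) : Prop :=
  (N (x-1) (y-2) x (y-2) ∧ N x (y-2) x (y-1) ∧ N x (y-1) (x+1) (y-1)) ∨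
  (N (x+1) y (x+1) (y-1) ∧ N (x+1) (y-1) x (y-1) ∧ N x (y-1) x (y-2)) ∨
  (N x (y+1) (x-1) (y+1) ∧ N (x-1) (y+1) (x-1) y ∧ N (x-1) y (x-2) y) ∨
  (N (x-2) (y-1) (x-2) y ∧ N (x-2) y (x-1) y ∧ N (x-1) y (x-1) (y+1)) ∨
  (N (x-3) (y-2) (x-2) (y-2) ∧ N (x-2) (y-2) (x-1) (y-2) ∧ N (x-1) (y-2) (x-1) (y-1) ∧
    N (x-1) (y-1) x (y-1) ∧ N x (y-1) (x+1) (y-1)) ∨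
  (N (x+1) (y+2) (x+1) (y+1) ∧ N (x+1) (y+1) (x+1) y ∧ N (x+1) y x y ∧
    N x y x (y-1) ∧ N x (y-1) x (y-2)) ∨
  (N (x+2) (y+1) (x+1) (y+1) ∧ N (x+1) (y+1) x (y+1) ∧ N x (y+1) x y ∧
    N x y (x-1) y ∧ N (x-1) y (x-2) y) ∨
  (N (x-2) (y-3) (x-2) (y-2) ∧ N (x-2) (y-2) (x-2) (y-1) ∧ N (x-2) (y-1) (x-1) (y-1) ∧
    N (x-1) (y-1) (x-1) y ∧ N (x-1) y (x-1) (y+1))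

def PD (N : ℤ → ℤ → ℤ → ℤ → Prop) (x y : ℤ) : Prop := ∃ a b, N x y a b

def AdjD (a b c d : ℤ) : Prop :=
  (c = a + 1 ∧ d = b) ∨ (c = a - 1 ∧ d = b) ∨ (c = a ∧ d = b + 1) ∨ (c = a ∧ d = b - 1)

structure Sys where
  N : ℤ → ℤ → ℤ → ℤ → Prop
  dg : ℤ → ℤ → ℤ → ℤ → Prop
  adj : ∀ {a b c d}, N a b c d → AdjD a b c d
  nu : ∀ {a b c d c' d'}, N a b c d → N a b c' d' → c = c' ∧ d = d'
  pu : ∀ {a b c d a' b'}, N a b c d → N a' b' c d → a = a' ∧ b = b'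
  ne : ∀ {a b c d}, N a b c d → ∃ e f, N c d e f
  pe : ∀ {a b c d}, N a b c d → ∃ e f, N e f a b
  no2 : ∀ {a b c d}, N a b c d → ¬ N c d a b
  no4 : ∀ {a b c d e f g h}, N a b c d → N c d e f → N e f g h → ¬ N g h a b
  t1 : ∀ {a b c d}, PD N a b → PD N c d → AdjD a b c d → N a b c d ∨ N c d a b
  tA : ∀ {x y}, PD N x y → PD N (x+1) (y+1) → ∃ a b, (N x y a b ∧ N a b (x+1) (y+1)) ∨
    (N (x+1) (y+1) a b ∧ N a b x y)
  tD : ∀ {x y}, PD N (x+1) y → PD N x (y+1) → ∃ a b, (N (x+1) y a b ∧ N a b x (y+1)) ∨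
    (N x (y+1) a b ∧ N a b (x+1) y)
  dgf : ∀ {a b c d}, a < c → b < d → ¬ YD N a b → ¬ YD N c d → ¬ YD N a d → ¬ YD N c b → dg a b c d
  dga : ∀ {a b c d}, a < c → b < d → ¬ YD N a b → ¬ YD N c d → YD N a d ∨ YD N c b → ¬ dg a b c d

namespace Sys

theorem trkey (N : ℤ → ℤ → ℤ → ℤ → Prop) (x y : ℤ) :
    YD (fun a b c d => N b a d c) x y ↔ YD N y x := by
  constructor
  · rintro (h|h|h|h|h|h|h|h)
    · exact .inr (.inr (.inr (.inl h)))
    · exact .inr (.inr (.inl h))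
    · exact .inr (.inl h)
    · exact .inl h
    · exact .inr (.inr (.inr (.inr (.inr (.inr (.inr h))))))
    · exact .inr (.inr (.inr (.inr (.inr (.inr (.inl h))))))
    · exact .inr (.inr (.inr (.inr (.inr (.inl h)))))
    · exact .inr (.inr (.inr (.inr (.inl h))))
  · rintro (h|h|h|h|h|h|h|h)
    · exact .inr (.inr (.inr (.inl h)))
    · exact .inr (.inr (.inl h))
    · exact .inr (.inl h)
    · exact .inl h
    · exact .inr (.inr (.inr (.inr (.inr (.inr (.inr h))))))
    · exact .inr (.inr (.inr (.inr (.inr (.inr (.inl h))))))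
    · exact .inr (.inr (.inr (.inr (.inr (.inl h)))))
    · exact .inr (.inr (.inr (.inr (.inl h))))

def tr (S : Sys) : Sys where
  N a b c d := S.N b a d c
  dg a b c d := S.dg b a d c
  adj h := by have := S.adj h; simp only [AdjD] at *; tauto
  nu h h' := (S.nu h h').symm
  pu h h' := (S.pu h h').symm
  ne h := by obtain ⟨e, f, h⟩ := S.ne h; exact ⟨f, e, h⟩
  pe h := by obtain ⟨e, f, h⟩ := S.pe h; exact ⟨f, e, h⟩
  no2 h := S.no2 h
  no4 h h1 h2 := S.no4 h h1 h2
  t1 := by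
    rintro a b c d ⟨e, f, h⟩ ⟨e', f', h'⟩ h2
    exact S.t1 ⟨_, _, h⟩ ⟨_, _, h'⟩ (by simp only [AdjD] at *; tauto)
  tA := by
    rintro x y ⟨e, f, h⟩ ⟨e', f', h'⟩
    obtain ⟨a, b, h⟩ := S.tA ⟨_, _, h⟩ ⟨_, _, h'⟩
    exact ⟨b, a, h⟩
  tD := by
    rintro x y ⟨e, f, h⟩ ⟨e', f', h'⟩
    obtain ⟨a, b, h⟩ := S.tD ⟨_, _, h'⟩ ⟨_, _, h⟩
    exact ⟨b, a, h.symm⟩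
  dgf := by
    have key := trkey S.N
    intro a b c d h1 h2 h3 h4 h5 h6
    rw [key] at *
    exact S.dgf h2 h1 h3 h4 h6 h5
  dga := by
    have key := trkey S.N
    intro a b c d h1 h2 h3 h4 h5
    rw [key] at *
    rw [key] at h5
    exact S.dga h2 h1 h3 h4 h5.symm

theorem rokey (N : ℤ → ℤ → ℤ → ℤ → Prop) (x y : ℤ) :
    YD (fun a b c d => N (-1-a) (-1-b) (-1-c) (-1-d)) x y ↔ YD N (-x) (-y) := by
  have e (z : ℤ) : (-1 - (z - 1) = -z ∧ -1 - (z - 2) = -z + 1) ∧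
    (-1 - (z + 1) = -z - 2 ∧ -1 - (z + 2) = -z - 3 ∧ -1 - (z - 3) = -z + 2) := by omega
  have e1 : -1 - x = -x - 1 := by omega
  have e2 : -1 - y = -y - 1 := by omega
  simp only [YD, e, e1, e2]
  constructor
  · rintro (h|h|h|h|h|h|h|h)
    · exact .inr (.inr (.inl h))
    · exact .inr (.inr (.inr (.inl h)))
    · exact .inl h
    · exact .inr (.inl h)
    · exact .inr (.inr (.inr (.inr (.inr (.inr (.inl h))))))
    · exact .inr (.inr (.inr (.inr (.inr (.inr (.inr h))))))
    · exact .inr (.inr (.inr (.inr (.inl h))))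
    · exact .inr (.inr (.inr (.inr (.inr (.inl h)))))
  · rintro (h|h|h|h|h|h|h|h)
    · exact .inr (.inr (.inl h))
    · exact .inr (.inr (.inr (.inl h)))
    · exact .inl h
    · exact .inr (.inl h)
    · exact .inr (.inr (.inr (.inr (.inr (.inr (.inl h))))))
    · exact .inr (.inr (.inr (.inr (.inr (.inr (.inr h))))))
    · exact .inr (.inr (.inr (.inr (.inl h))))
    · exact .inr (.inr (.inr (.inr (.inr (.inl h)))))

def ro (S : Sys) : Sys where
  N a b c d := S.N (-1-a) (-1-b) (-1-c) (-1-d)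
  dg a b c d := S.dg (-c) (-d) (-a) (-b)
  adj h := by have := S.adj h; simp only [AdjD] at *; omega
  nu h h' := by have := S.nu h h'; omega
  pu h h' := by have := S.pu h h'; omega
  ne h := by
    obtain ⟨e, f, h⟩ := S.ne h
    exact ⟨-1-e, -1-f, by simpa using h⟩
  pe h := by
    obtain ⟨e, f, h⟩ := S.pe h
    exact ⟨-1-e, -1-f, by simpa using h⟩
  no2 h := S.no2 h
  no4 h h1 h2 := S.no4 h h1 h2
  t1 := by
    rintro a b c d ⟨e, f, h⟩ ⟨e', f', h'⟩ h2
    exact S.t1 ⟨_, _, h⟩ ⟨_, _, h'⟩ (by simp only [AdjD] at *; omega)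
  tA := by
    rintro x y ⟨e, f, h⟩ ⟨e', f', h'⟩
    have e1 (z : ℤ) : -1 - z = -1 - (z + 1) + 1 := by ring
    rw [e1 x, e1 y] at h
    obtain ⟨a, b, h⟩ := S.tA ⟨_, _, h'⟩ ⟨_, _, h⟩
    rw [← e1 x, ← e1 y] at h
    exact ⟨-1-a, -1-b, by simpa using h.symm⟩
  tD := by
    rintro x y ⟨e, f, h⟩ ⟨e', f', h'⟩
    have e1 (z : ℤ) : -1 - z = -1 - (z + 1) + 1 := by ring
    rw [e1 x] at h'
    rw [e1 y] at h
    obtain ⟨a, b, h⟩ := S.tD ⟨_, _, h'⟩ ⟨_, _, h⟩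
    rw [← e1 x, ← e1 y] at h
    exact ⟨-1-a, -1-b, by simpa using h.symm⟩
  dgf := by
    intro a b c d h1 h2 h3 h4 h5 h6
    rw [rokey] at *
    exact S.dgf (by omega) (by omega) h4 h3 h6 h5
  dga := by
    intro a b c d h1 h2 h3 h4 h5
    rw [rokey] at *
    rw [rokey] at h5
    exact S.dga (by omega) (by omega) h4 h3 h5.symm

variable (S : Sys)

theorem nbr {S : Sys} {a b c d e f g h : ℤ} (h1 : S.N a b c d) (h2 : S.N c d e f) (hp : PD S.N g h)
    (ha : AdjD g h c d) : (g = a ∧ h = b) ∨ (g = e ∧ h = f) := by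
  rcases S.t1 hp ⟨_, _, h2⟩ ha with h3 | h3
  · exact Or.inl (S.pu h3 h1)
  · exact Or.inr (S.nu h3 h2)

theorem pl {a b c d} (h : S.N a b c d) : PD S.N a b := ⟨_, _, h⟩
theorem pr {a b c d} (h : S.N a b c d) : PD S.N c d := by
  obtain ⟨e, f, h⟩ := S.ne h; exact ⟨_, _, h⟩

theorem nosq {x y} (h1 : PD S.N x y) (h2 : PD S.N (x+1) y) (h3 : PD S.N x (y+1))
    (h4 : PD S.N (x+1) (y+1)) : False := by
  have a := S.t1 h1 h2 (by simp [AdjD])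
  have b := S.t1 h1 h3 (by simp [AdjD])
  have c := S.t1 h2 h4 (by simp [AdjD])
  have d := S.t1 h3 h4 (by simp [AdjD])
  rcases a with a | a <;> rcases b with b | b
  · have := S.nu a b; omega
  · rcases c with c | c
    · rcases d with d | d
      · have := S.nu d b; omega
      · exact S.no4 a c d b
    · have := S.pu a c; omega
  · rcases c with c | c
    · have := S.nu a c; omega
    · rcases d with d | d
      · exact S.no4 b d c a
      · have := S.pu b d; omega
  · have := S.pu a b; omega

end Sys

namespace Sys
variable {S : Sys}

theorem king {a b c d e f g h : ℤ} (h1 : S.N a b c d) (h2 : S.N c d e f) (hp : PD S.N g h)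
    (hk : c - 1 ≤ g ∧ g ≤ c + 1 ∧ d - 1 ≤ h ∧ h ≤ d + 1) :
    (g = c ∧ h = d) ∨ (g = a ∧ h = b) ∨ (g = e ∧ h = f) ∨ S.N g h a b ∨ S.N e f g h := by
  by_cases hc : g = c ∧ h = d
  · exact .inl hc
  by_cases hA : AdjD g h c d
  · rcases nbr h1 h2 hp hA with h | h <;> tauto
  have fin : ∀ {k l}, (S.N g h k l ∧ S.N k l c d) ∨ (S.N c d k l ∧ S.N k l g h) →
      S.N g h a b ∨ S.N e f g h := by
    rintro k l (⟨u, v⟩ | ⟨u, v⟩)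
    · obtain ⟨rfl, rfl⟩ := S.pu v h1; exact .inl u
    · obtain ⟨rfl, rfl⟩ := S.nu u h2; exact .inr v
  have hc' : PD S.N c d := ⟨_, _, h2⟩
  have : (c = g + 1 ∧ d = h + 1) ∨ (g = c + 1 ∧ h = d + 1) ∨ (g = c + 1 ∧ d = h + 1) ∨ (c = g + 1 ∧ h = d + 1) := by
    simp only [AdjD] at hA; omega
  rcases this with ⟨rfl, rfl⟩ | ⟨rfl, rfl⟩ | ⟨rfl, rfl⟩ | ⟨rfl, rfl⟩
  · obtain ⟨k, l, hh⟩ := S.tA hp hc'; exact .inr (.inr (.inr (fin hh)))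
  · obtain ⟨k, l, hh⟩ := S.tA hc' hp; exact .inr (.inr (.inr (fin hh.symm)))
  · obtain ⟨k, l, hh⟩ := S.tD hp hc'; exact .inr (.inr (.inr (fin hh)))
  · obtain ⟨k, l, hh⟩ := S.tD hc' hp; exact .inr (.inr (.inr (fin hh.symm)))

theorem kingA {a b c d e f g h : ℤ} (h1 : S.N a b c d) (h2 : S.N c d e f) (hp : PD S.N g h)
    (hk : c - 1 ≤ g ∧ g ≤ c + 1 ∧ d - 1 ≤ h ∧ h ≤ d + 1) :
    (g = c ∧ h = d) ∨ (g = a ∧ h = b) ∨ (g = e ∧ h = f) ∨ AdjD g h a b ∨ AdjD e f g h := by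
  rcases king h1 h2 hp hk with h | h | h | h | h
  · tauto
  · tauto
  · tauto
  · have := S.adj h; tauto
  · have := S.adj h; tauto

theorem Yv {x y : ℤ} (h : YD S.N x y) :
    (PD S.N x (y-1) ∧ ¬ PD S.N (x-1) (y-1) ∧ ¬ PD S.N (x-1) y ∧ ¬ PD S.N x y) ∨
    (PD S.N (x-1) y ∧ ¬ PD S.N (x-1) (y-1) ∧ ¬ PD S.N x (y-1) ∧ ¬ PD S.N x y) ∨
    (S.N (x-1) (y-1) x (y-1) ∧ S.N (x-1) (y-2) (x-1) (y-1) ∧ S.N x (y-1) (x+1) (y-1) ∧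
      ¬ PD S.N (x-1) y ∧ ¬ PD S.N x y) ∨
    (S.N x y x (y-1) ∧ S.N (x+1) y x y ∧ S.N x (y-1) x (y-2) ∧
      ¬ PD S.N (x-1) y ∧ ¬ PD S.N (x-1) (y-1)) ∨
    (S.N x y (x-1) y ∧ S.N x (y+1) x y ∧ S.N (x-1) y (x-2) y ∧
      ¬ PD S.N (x-1) (y-1) ∧ ¬ PD S.N x (y-1)) ∨
    (S.N (x-1) (y-1) (x-1) y ∧ S.N (x-2) (y-1) (x-1) (y-1) ∧ S.N (x-1) y (x-1) (y+1) ∧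
      ¬ PD S.N x (y-1) ∧ ¬ PD S.N x y) := by
  rcases h with ⟨h1, h2, h3⟩ | ⟨h1, h2, h3⟩ | ⟨h1, h2, h3⟩ | ⟨h1, h2, h3⟩ |
    ⟨h1, h2, h3, h4, h5⟩ | ⟨h1, h2, h3, h4, h5⟩ | ⟨h1, h2, h3, h4, h5⟩ | ⟨h1, h2, h3, h4, h5⟩
  · refine .inl ⟨⟨_, _, h3⟩, ?_, ?_, ?_⟩ <;>
    · intro hp; have := kingA h2 h3 hp (by omega); simp only [AdjD] at this; omega
  · refine .inl ⟨⟨_, _, h3⟩, ?_, ?_, ?_⟩ <;>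
    · intro hp; have := kingA h2 h3 hp (by omega); simp only [AdjD] at this; omega
  · refine .inr (.inl ⟨⟨_, _, h3⟩, ?_, ?_, ?_⟩) <;>
    · intro hp; have := kingA h2 h3 hp (by omega); simp only [AdjD] at this; omega
  · refine .inr (.inl ⟨⟨_, _, h3⟩, ?_, ?_, ?_⟩) <;>
    · intro hp; have := kingA h2 h3 hp (by omega); simp only [AdjD] at this; omega
  · refine .inr (.inr (.inl ⟨h4, h3, h5, ?_, ?_⟩)) 
    · intro hp; have := kingA h3 h4 hp (by omega); simp only [AdjD] at this; omega
    · intro hp; have := kingA h4 h5 hp (by omega); simp only [AdjD] at this; omega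
  · refine .inr (.inr (.inr (.inl ⟨h4, h3, h5, ?_, ?_⟩)))
    · intro hp; have := kingA h3 h4 hp (by omega); simp only [AdjD] at this; omega
    · intro hp; have := kingA h4 h5 hp (by omega); simp only [AdjD] at this; omega
  · refine .inr (.inr (.inr (.inr (.inl ⟨h4, h3, h5, ?_, ?_⟩))))
    · intro hp; have := kingA h4 h5 hp (by omega); simp only [AdjD] at this; omega
    · intro hp; have := kingA h3 h4 hp (by omega); simp only [AdjD] at this; omega
  · refine .inr (.inr (.inr (.inr (.inr ⟨h4, h3, h5, ?_, ?_⟩))))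
    · intro hp; have := kingA h3 h4 hp (by omega); simp only [AdjD] at this; omega
    · intro hp; have := kingA h4 h5 hp (by omega); simp only [AdjD] at this; omega
end Sys

namespace Sys
variable {S : Sys}

theorem nF {a b c d a' b' c' d' : ℤ} (h : S.N a b c d) (h' : S.N a' b' c' d')
    (e : a = a' ∧ b = b' ∧ ¬ (c = c' ∧ d = d')) : False := by
  obtain ⟨rfl, rfl, e⟩ := e; exact e (S.nu h h')

theorem pF {a b c d a' b' c' d' : ℤ} (h : S.N a b c d) (h' : S.N a' b' c' d')
    (e : c = c' ∧ d = d' ∧ ¬ (a = a' ∧ b = b')) : False := by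
  obtain ⟨rfl, rfl, e⟩ := e; exact e (S.pu h h')

theorem rF {a b c d a' b' c' d' : ℤ} (h : S.N a b c d) (h' : S.N a' b' c' d')
    (e : c = a' ∧ d = b' ∧ a = c' ∧ b = d') : False := by
  obtain ⟨rfl, rfl, rfl, rfl⟩ := e; exact S.no2 h h'

theorem kF {a b c d e f g h : ℤ} (h1 : S.N a b c d) (h2 : S.N c d e f) (hp : PD S.N g h)
    (hk : (c - 1 ≤ g ∧ g ≤ c + 1 ∧ d - 1 ≤ h ∧ h ≤ d + 1) ∧
      ¬ ((g = c ∧ h = d) ∨ (g = a ∧ h = b) ∨ (g = e ∧ h = f)) ∧ ¬ AdjD g h a b ∧ ¬ AdjD e f g h) :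
    False := by
  have := kingA h1 h2 hp hk.1
  tauto

theorem Y_SW {x y : ℤ} (h : YD S.N x y) (hp : PD S.N (x-1) (y-1)) :
  (S.N (x-3) (y-2) (x-2) (y-2) ∧ S.N (x-2) (y-2) (x-1) (y-2) ∧ S.N (x-1) (y-2) (x-1) (y-1) ∧
    S.N (x-1) (y-1) x (y-1) ∧ S.N x (y-1) (x+1) (y-1)) ∨
  (S.N (x-2) (y-3) (x-2) (y-2) ∧ S.N (x-2) (y-2) (x-2) (y-1) ∧ S.N (x-2) (y-1) (x-1) (y-1) ∧
    S.N (x-1) (y-1) (x-1) y ∧ S.N (x-1) y (x-1) (y+1)) := by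
  rcases h with h | h | h | h | h | h | h | h
  · exact (kF h.2.1 h.2.2 hp (by simp only [AdjD]; omega)).elim
  · exact (kF h.2.1 h.2.2 hp (by simp only [AdjD]; omega)).elim
  · exact (kF h.2.1 h.2.2 hp (by simp only [AdjD]; omega)).elim
  · exact (kF h.2.1 h.2.2 hp (by simp only [AdjD]; omega)).elim
  · exact .inl h
  · exact (kF h.2.2.2.1 h.2.2.2.2 hp (by simp only [AdjD]; omega)).elim
  · exact (kF h.2.2.2.1 h.2.2.2.2 hp (by simp only [AdjD]; omega)).elim
  · exact .inr h

theorem Y_NE {x y : ℤ} (h : YD S.N x y) (hp : PD S.N x y) :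
  (S.N (x+1) (y+2) (x+1) (y+1) ∧ S.N (x+1) (y+1) (x+1) y ∧ S.N (x+1) y x y ∧
    S.N x y x (y-1) ∧ S.N x (y-1) x (y-2)) ∨
  (S.N (x+2) (y+1) (x+1) (y+1) ∧ S.N (x+1) (y+1) x (y+1) ∧ S.N x (y+1) x y ∧
    S.N x y (x-1) y ∧ S.N (x-1) y (x-2) y) := by
  rcases h with h | h | h | h | h | h | h | h
  · exact (kF h.2.1 h.2.2 hp (by simp only [AdjD]; omega)).elim
  · exact (kF h.2.1 h.2.2 hp (by simp only [AdjD]; omega)).elim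
  · exact (kF h.2.1 h.2.2 hp (by simp only [AdjD]; omega)).elim
  · exact (kF h.2.1 h.2.2 hp (by simp only [AdjD]; omega)).elim
  · exact (kF h.2.2.2.1 h.2.2.2.2 hp (by simp only [AdjD]; omega)).elim
  · exact .inl h
  · exact .inr h
  · exact (kF h.2.2.2.1 h.2.2.2.2 hp (by simp only [AdjD]; omega)).elim

theorem Y_NW {x y : ℤ} (h : YD S.N x y) (hp : PD S.N (x-1) y) :
  (S.N x (y+1) (x-1) (y+1) ∧ S.N (x-1) (y+1) (x-1) y ∧ S.N (x-1) y (x-2) y) ∨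
  (S.N (x-2) (y-1) (x-2) y ∧ S.N (x-2) y (x-1) y ∧ S.N (x-1) y (x-1) (y+1)) ∨
  (S.N (x+2) (y+1) (x+1) (y+1) ∧ S.N (x+1) (y+1) x (y+1) ∧ S.N x (y+1) x y ∧
    S.N x y (x-1) y ∧ S.N (x-1) y (x-2) y) ∨
  (S.N (x-2) (y-3) (x-2) (y-2) ∧ S.N (x-2) (y-2) (x-2) (y-1) ∧ S.N (x-2) (y-1) (x-1) (y-1) ∧
    S.N (x-1) (y-1) (x-1) y ∧ S.N (x-1) y (x-1) (y+1)) := by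
  rcases h with h | h | h | h | h | h | h | h
  · exact (kF h.2.1 h.2.2 hp (by simp only [AdjD]; omega)).elim
  · exact (kF h.2.1 h.2.2 hp (by simp only [AdjD]; omega)).elim
  · exact .inl h
  · exact .inr (.inl h)
  · exact (kF h.2.2.1 h.2.2.2.1 hp (by simp only [AdjD]; omega)).elim
  · exact (kF h.2.2.1 h.2.2.2.1 hp (by simp only [AdjD]; omega)).elim
  · exact .inr (.inr (.inl h))
  · exact .inr (.inr (.inr h))

/-- runs -/
theorem run_right {x y : ℤ} (h : S.N x y (x+1) y) (n : ℕ)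
    (hp : ∀ t : ℤ, x ≤ t → t ≤ x + n → PD S.N t y) : ∀ t : ℤ, x ≤ t → t < x + n → S.N t y (t+1) y := by
  induction n with
  | zero => intro t h1 h2; simp at h2; omega
  | succ n ih =>
    intro t h1 h2
    push_cast at hp h2
    have ih := ih (fun t h1 h2 => hp t h1 (by omega))
    by_cases ht : t < x + n
    · exact ih t h1 ht
    by_cases hx : t = x
    · subst hx; exact h
    have h3 := ih (t-1) (by omega) (by omega)
    rw [sub_add_cancel] at h3
    rcases S.t1 (hp t h1 (by omega)) (hp (t+1) (by omega) (by omega)) (by simp [AdjD]) with h4 | h4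
    · exact h4
    · exact (pF h3 h4 (by omega)).elim

theorem run_up {x y : ℤ} (h : S.N x y x (y+1)) (n : ℕ)
    (hp : ∀ t : ℤ, y ≤ t → t ≤ y + n → PD S.N x t) : ∀ t : ℤ, y ≤ t → t < y + n → S.N x t x (t+1) :=
  run_right (S := S.tr) h n (fun t h1 h2 => by obtain ⟨e, f, h⟩ := hp t h1 h2; exact ⟨f, e, h⟩)

theorem run_down {x y : ℤ} (h : S.N x y x (y-1)) (n : ℕ)
    (hp : ∀ t : ℤ, y - n ≤ t → t ≤ y → PD S.N x t) : ∀ t : ℤ, y - n < t → t ≤ y → S.N x t x (t-1) := by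
  induction n with
  | zero => intro t h1 h2; simp at h1; omega
  | succ n ih =>
    intro t h1 h2
    push_cast at hp h1
    have ih := ih (fun t h1 h2 => hp t (by omega) (by omega))
    by_cases ht : y - n < t
    · exact ih t ht h2
    by_cases hx : t = y
    · subst hx; exact h
    have h3 := ih (t+1) (by omega) (by omega)
    rw [add_sub_cancel_right] at h3
    rcases S.t1 (hp t (by omega) (by omega)) (hp (t-1) (by omega) (by omega)) (by simp [AdjD]) with h4 | h4
    · exact h4
    · exact (pF h3 h4 (by omega)).elim

/-- backward run: incoming vertical arm from below -/
theorem back_up {x y : ℤ} (h : S.N x (y-1) x y) (n : ℕ)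
    (hp : ∀ t : ℤ, y - 1 - n ≤ t → t ≤ y → PD S.N x t) :
    ∀ t : ℤ, y - 1 - n ≤ t → t < y → S.N x t x (t+1) := by
  induction n with
  | zero => intro t h1 h2; simp at h1; obtain rfl : t = y - 1 := by omega
            simpa using h
  | succ n ih =>
    intro t h1 h2
    push_cast at hp h1
    have ih := ih (fun t h1 h2 => hp t (by omega) (by omega))
    by_cases ht : y - 1 - n ≤ t
    · exact ih t ht h2
    have h3 := ih (t+1) (by omega) (by omega)
    rcases S.t1 (hp t (by omega) (by omega)) (hp (t+1) (by omega) (by omega)) (by simp [AdjD]) with h4 | h4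
    · exact h4
    · exact (nF h3 h4 (by omega)).elim

end Sys

namespace Sys
variable {S : Sys}

theorem PDc {a b a' b' : ℤ} (h : PD S.N a b) (e : a' = a ∧ b' = b) : PD S.N a' b' := by
  obtain ⟨rfl, rfl⟩ := e; exact h

theorem Nc {a b c d a' b' c' d' : ℤ} (h : S.N a b c d) (e : a' = a ∧ b' = b ∧ c' = c ∧ d' = d) :
    S.N a' b' c' d' := by
  obtain ⟨rfl, rfl, rfl, rfl⟩ := e; exact h

theorem rr {x y k : ℤ} (h : S.N x y (x+1) y) 
    (hp : ∀ t : ℤ, x ≤ t → t < k → PD S.N t y) : ∀ t : ℤ, x ≤ t → t + 1 < k → S.N t y (t+1) y := by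
  intro t h1 h2
  exact run_right h (k - 1 - x).toNat (fun t h1 h2 => hp t h1 (by omega)) t h1 (by omega)

theorem ru {x y k : ℤ} (h : S.N x y x (y+1))
    (hp : ∀ t : ℤ, y ≤ t → t < k → PD S.N x t) : ∀ t : ℤ, y ≤ t → t + 1 < k → S.N x t x (t+1) := by
  intro t h1 h2
  exact run_up h (k - 1 - y).toNat (fun t h1 h2 => hp t h1 (by omega)) t h1 (by omega)

theorem rd {x y k : ℤ} (h : S.N x y x (y-1))
    (hp : ∀ t : ℤ, k ≤ t → t ≤ y → PD S.N x t) : ∀ t : ℤ, k < t → t ≤ y → S.N x t x (t-1) := by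
  intro t h1 h2
  exact run_down h (y - k).toNat (fun t h1 h2 => hp t (by omega) (by omega)) t (by omega) (by omega)

theorem bu {x y k : ℤ} (h : S.N x (y-1) x y)
    (hp : ∀ t : ℤ, k ≤ t → t ≤ y → PD S.N x t) : ∀ t : ℤ, k ≤ t → t < y → S.N x t x (t+1) := by
  intro t h1 h2
  exact back_up h (y - 1 - k).toNat (fun t h1 h2 => hp t (by omega) (by omega)) t (by omega) (by omega)

/-- vertex `(x,y)`, cells around. -/
theorem nY_inner {x y : ℤ} (h1 : PD S.N x (y-1)) (h2 : PD S.N x y) (h3 : PD S.N (x+1) y) :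
    ¬ YD S.N (x+1) y := by
  intro h
  have h1' : PD S.N (x+1-1) (y-1) := PDc h1 (by omega)
  rcases Y_SW h h1' with c | c
  · exact kF c.2.2.1 c.2.2.2.1 h2 (by simp only [AdjD]; omega)
  · exact kF c.2.2.2.1 c.2.2.2.2 h3 (by simp only [AdjD]; omega)

theorem nY_llup {x y c d : ℤ} (h1 : S.N x y c d) (e : (c = x ∧ d = y + 1) ∨ (c = x + 1 ∧ d = y)) :
    ¬ YD S.N x y := by
  intro h
  rcases Y_NE h ⟨_, _, h1⟩ with c | c
  · exact nF h1 c.2.2.2.1 (by omega)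
  · exact nF h1 c.2.2.2.1 (by omega)

/-- end vertex of next arm, upper -/
theorem nY_armU {x y k : ℤ} (h2 : S.N x y (x+1) y) (hk : x + 2 ≤ k)
    (hp : ∀ t, x ≤ t → t < k → PD S.N t y) 
    (hx : ∀ z, S.N (x+1) y z (y+1) → ¬ S.N x (y-1) x y ∨ S.N (x-1) (y-1) x (y-1)) : ¬ YD S.N k (y+1) := by
  intro h
  have hr := rr h2 hp
  have h3 := hr (k-2) (by omega) (by omega)
  have hsw : PD S.N (k-1) (y+1-1) := PDc (hp (k-1) (by omega) (by omega)) (by omega)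
  rcases Y_SW h hsw with c | c
  · exact pF c.2.2.1 h3 (by omega)
  · by_cases e : k = x + 2
    · subst e
      have c4 : S.N (x+1) y (x+1) (y+1) := Nc c.2.2.2.1 (by omega)
      rcases hx _ c4 with h | h
      · exact h (Nc c.2.1 (by omega))
      · exact pF c.1 h (by omega)
    · exact pF c.2.1 (hr (k-3) (by omega) (by omega)) (by omega)

theorem prevB {x y : ℤ} (h1 : S.N x (y-1) x y) (h2 : S.N x y (x+1) y) :
    S.N x (y-2) x (y-1) ∨ S.N (x-1) (y-1) x (y-1) := by
  obtain ⟨a, b, h⟩ := S.pe h1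
  rcases S.adj h with e | e | e | e
  · exact .inr (Nc h (by omega))
  · exact (kF h1 h2 (g := x+1) (h := y-1) (PDc (S.pl h) (by omega)) (by
      simp only [AdjD]
      by_contra hh
      have hd : PD S.N (x+1) (y-1+1) := PDc (S.pr h2) (by omega)
      exact S.nosq (S.pl h1) (PDc (S.pl h) (by omega)) (PDc (S.pl h2) (by omega)) hd)).elim
  · exact .inl (Nc h (by omega))
  · exact (rF h h1 (by omega)).elim

theorem nextD {x y : ℤ} (h1 : S.N x (y-1) x y) (h2 : S.N x y (x+1) y) :
    S.N (x+1) y (x+2) y ∨ S.N (x+1) y (x+1) (y+1) := by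
  obtain ⟨a, b, h⟩ := S.ne h2
  rcases S.adj h with e | e | e | e
  · exact .inl (Nc h (by omega))
  · exact (rF h2 h (by omega)).elim
  · exact .inr (Nc h (by omega))
  · exfalso
    have hd : PD S.N (x+1) (y-1+1) := PDc (S.pr h2) (by omega)
    exact S.nosq (S.pl h1) (PDc (S.pr h) (by omega)) (PDc (S.pl h2) (by omega)) hd

theorem prevA {x y : ℤ} (h0 : S.N (x-1) (y-1) x (y-1)) (h1 : S.N x (y-1) x y) :
    S.N (x-2) (y-1) (x-1) (y-1) ∨ S.N (x-1) (y-2) (x-1) (y-1) := by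
  obtain ⟨a, b, h⟩ := S.pe h0
  rcases S.adj h with e | e | e | e
  · exact .inl (Nc h (by omega))
  · exact (rF h h0 (by omega)).elim
  · exact .inr (Nc h (by omega))
  · exfalso
    exact S.nosq (S.pl h0) (PDc (S.pl h1) (by omega)) (PDc (S.pl h) (by omega)) (PDc (S.pr h1) (by omega))

/-- Corner, representative 1. -/
theorem corner1 {x y k h : ℤ} (h1 : S.N x (y-1) x y) (h2 : S.N x y (x+1) y)
    (hk : x + 2 ≤ k) (hh : h ≤ y - 1)
    (hp : ∀ t, x ≤ t → t < k → PD S.N t y) (hq : ∀ t, h ≤ t → t ≤ y → PD S.N x t) :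
    (S.dg x y k (y+1) ↔ S.dg (x+1) y k (y+1)) ∨ (S.dg x h (x+1) (y+1) ↔ S.dg x h (x+1) y) := by
  have nV : ¬ YD S.N (x+1) y := nY_inner (S.pl h1) (S.pl h2) (S.pr h2)
  have nC : ¬ YD S.N x y := nY_llup h2 (by omega)
  have nU (hx : ¬ (S.N (x-2) (y-1) (x-1) (y-1) ∧ S.N (x-1) (y-1) x (y-1))) : ¬ YD S.N (x+1) (y+1) := by
    intro hY
    rcases Y_SW hY (PDc (S.pl h2) (by omega)) with c | c
    · exact hx ⟨Nc c.1 (by omega), Nc c.2.1 (by omega)⟩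
    · exact nF h2 c.2.2.2.1 (by omega)
  have nH : ¬ YD S.N x h := nY_llup (bu h1 hq h le_rfl (by omega)) (by omega)
  rcases prevB h1 h2 with h0 | h0
  · right
    have nT : ¬ YD S.N x (y+1) := by
      rintro (c | c | c | c | c | c | c | c)
      · exact pF c.1 h0 (by omega)
      · exact pF c.2.1 h1 (by omega)
      · exact kF c.2.1 c.2.2 (S.pl h2) (by simp only [AdjD]; omega)
      · exact kF c.2.1 c.2.2 (S.pl h2) (by simp only [AdjD]; omega)
      · exact pF c.2.2.2.1 h1 (by omega)
      · exact nF c.2.2.2.2 h2 (by omega)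
      · exact kF c.2.2.1 c.2.2.2.1 (S.pl h2) (by simp only [AdjD]; omega)
      · exact kF c.2.2.1 c.2.2.2.1 (S.pl h2) (by simp only [AdjD]; omega)
    have nU := nU (fun hx => pF hx.2 h0 (by omega))
    by_cases hd : YD S.N (x+1) h
    · exact iff_of_false (S.dga (by omega) (by omega) nH nU (.inr hd))
        (S.dga (by omega) (by omega) nH nV (.inr hd))
    · exact iff_of_true (S.dgf (by omega) (by omega) nH nU nT hd)
        (S.dgf (by omega) (by omega) nH nV nC hd)
  have eh : h = y - 1 := by
    by_contra e
    exact kF h0 h1 (hq (y-2) (by omega) (by omega)) (by simp only [AdjD]; omega)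
  subst eh
  have nK : ¬ YD S.N k (y+1) := nY_armU h2 hk hp (fun _ _ => .inr h0)
  have yT : YD S.N x (y+1) := .inl ⟨Nc h0 (by omega), Nc h1 (by omega), Nc h2 (by omega)⟩
  rcases nextD h1 h2 with h3 | h3
  · rcases prevA h0 h1 with hm | hm
    · left
      have yU : YD S.N (x+1) (y+1) := .inr (.inr (.inr (.inr (.inl
        ⟨Nc hm (by omega), Nc h0 (by omega), Nc h1 (by omega), Nc h2 (by omega), Nc h3 (by omega)⟩))))
      exact iff_of_false (S.dga (by omega) (by omega) nC nK (.inl yT))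
        (S.dga (by omega) (by omega) nV nK (.inl yU))
    · right
      have yR : YD S.N (x+1) (y-1) := .inr (.inr (.inr (.inl
        ⟨Nc hm (by omega), Nc h0 (by omega), Nc h1 (by omega)⟩)))
      have nU := nU (fun hx => pF hm hx.1 (by omega))
      exact iff_of_false (S.dga (by omega) (by omega) nH nU (.inr yR))
        (S.dga (by omega) (by omega) nH nV (.inr yR))
  · left
    have ek : k = x + 2 := by
      by_contra e
      exact kF h2 h3 (hp (x+2) (by omega) (by omega)) (by simp only [AdjD]; omega)
    subst ek
    have yR : YD S.N (x+2) y := .inr (.inr (.inr (.inl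
        ⟨Nc h1 (by omega), Nc h2 (by omega), Nc h3 (by omega)⟩)))
    exact iff_of_false (S.dga (by omega) (by omega) nC nK (.inr yR))
        (S.dga (by omega) (by omega) nV nK (.inr yR))

/-- Corner, representative 2: Y-freeness. -/
theorem free2 {x y k : ℤ} (h1 : S.N x (y+1) x y) (h2 : S.N x y (x+1) y)
    (hk : x + 2 ≤ k) (hp : ∀ t, x ≤ t → t < k → PD S.N t y) :
    ¬ YD S.N x y ∧ ¬ YD S.N x (y+1) ∧ ¬ YD S.N (x+1) y ∧ ¬ YD S.N (x+1) (y+1) ∧ ¬ YD S.N k y ∧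
    ¬ YD S.N k (y+1) := by
  refine ⟨nY_llup h2 (by omega), ?_, ?_, ?_, ?_, ?_⟩
  · intro h
    rcases Y_NE h (S.pl h1) with c | c
    · exact nF c.2.2.2.2 h2 (by omega)
    · exact nF c.2.2.2.1 h1 (by omega)
  · intro h
    rcases Y_NE h (S.pr h2) with c | c
    · exact pF c.2.2.1 h2 (by omega)
    · exact pF c.2.2.1 h2 (by omega)
  · intro h
    rcases Y_SW h (PDc (S.pl h2) (by omega)) with c | c
    · exact pF c.2.2.1 h1 (by omega)
    · exact nF c.2.2.2.1 h2 (by omega)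
  · intro h
    have hr := rr h2 hp
    have h3 := hr (k-2) (by omega) (by omega)
    rcases Y_NW h (hp _ (by omega) (by omega)) with c | c | c | c
    · exact pF c.2.1 h3 (by omega)
    · by_cases e : k = x + 2
      · exact pF c.1 h1 (by omega)
      · exact pF c.1 (hr (k-3) (by omega) (by omega)) (by omega)
    · exact pF c.2.2.2.1 h3 (by omega)
    · exact pF c.2.2.2.1 h3 (by omega)
  · exact nY_armU h2 hk hp (fun _ _ => .inl (fun h => pF h h1 (by omega)))

theorem corner2 {x y k : ℤ} (h1 : S.N x (y+1) x y) (h2 : S.N x y (x+1) y)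
    (hk : x + 2 ≤ k) (hp : ∀ t, x ≤ t → t < k → PD S.N t y) :
    (S.dg x y k (y+1) ↔ S.dg (x+1) y k (y+1)) := by
  obtain ⟨a, b, c, d, e, f⟩ := free2 h1 h2 hk hp
  exact iff_of_true (S.dgf (by omega) (by omega) a f b e) (S.dgf (by omega) (by omega) c f d e)

/-- Opposite quadrants, representative 1. -/
theorem opp1 {x y i j i' j' : ℤ} (h1 : S.N x (y-1) x y) (h2 : S.N x y (x+1) y)
    (hi : 1 ≤ i) (hj : 1 ≤ j) (hi' : 1 ≤ i') (hj' : 1 ≤ j')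
    (hI : ∀ m n, x + 1 - i ≤ m → m < x + 1 → y - j ≤ n → n < y → PD S.N m n)
    (hJ : ∀ m n, x + 1 ≤ m → m < x + 1 + i' → y ≤ n → n < y + j' → PD S.N m n)
    (dI : S.dg (x+1-i) (y-j) (x+1) y) (dJ : S.dg (x+1) y (x+1+i') (y+j')) : i = 1 ∧ j' = 1 := by
  have nV : ¬ YD S.N (x+1) y := nY_inner (S.pl h1) (S.pl h2) (S.pr h2)
  have hB (e : i ≠ 1) : S.N (x-1) (y-1) x (y-1) := by
    rcases prevB h1 h2 with h | h
    · exact (kF h h1 (hI (x-1) (y-1) (by omega) (by omega) (by omega) (by omega))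
        (by simp only [AdjD]; omega)).elim
    · exact h
  rcases nextD h1 h2 with h3 | h3
  · have ej : j' = 1 := by
      by_contra e
      exact kF h2 h3 (hJ (x+1) (y+1) (by omega) (by omega) (by omega) (by omega)) (by simp only [AdjD]; omega)
    subst ej
    refine ⟨?_, rfl⟩
    by_contra e
    have h0 := hB e
    rcases prevA h0 h1 with hm | hm
    · have yU : YD S.N (x+1) (y+1) := .inr (.inr (.inr (.inr (.inl
        ⟨Nc hm (by omega), Nc h0 (by omega), Nc h1 (by omega), Nc h2 (by omega), Nc h3 (by omega)⟩))))
      have nK : ¬ YD S.N (x+1+i') (y+1) := nY_armU h2 (by omega) (fun t ht ht' => by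
        by_cases e : t = x
        · subst e; exact S.pl h2
        · exact hJ _ _ (by omega) (by omega) (by omega) (by omega)) (fun _ _ => .inr h0)
      exact S.dga (by omega) (by omega) nV nK (.inl yU) dJ
    · have yR : YD S.N (x+1) (y-1) := .inr (.inr (.inr (.inl
        ⟨Nc hm (by omega), Nc h0 (by omega), Nc h1 (by omega)⟩)))
      have ei : i = 2 := by
        by_contra e'
        exact kF hm h0 (hI (x-2) (y-1) (by omega) (by omega) (by omega) (by omega)) (by simp only [AdjD]; omega)
      have ej : j = 1 := by
        by_contra e'
        exact kF h0 h1 (hI x (y-2) (by omega) (by omega) (by omega) (by omega)) (by simp only [AdjD]; omega)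
      subst ei ej
      have nA : ¬ YD S.N (x+1-2) (y-1) := nY_llup (Nc h0 ⟨by omega, rfl, rfl, rfl⟩) (by omega)
      exact S.dga (by omega) (by omega) nA nV (.inr yR) dI
  · have ei : i' = 1 := by
      by_contra e
      exact kF h2 h3 (hJ (x+2) y (by omega) (by omega) (by omega) (by omega)) (by simp only [AdjD]; omega)
    subst ei
    have yR : YD S.N (x+1+1) y := .inr (.inr (.inr (.inl
        ⟨Nc h1 (by omega), Nc h2 (by omega), Nc h3 (by omega)⟩)))
    have nb (e : i ≠ 1 ∨ j' ≠ 1) : ¬ YD S.N (x+1+1) (y+j') := by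
      intro hY
      have hcol : ∀ t, y ≤ t → t < y + j' → PD S.N (x+1) t := fun t ht ht' =>
        hJ _ _ (by omega) (by omega) (by omega) (by omega)
      have hr := ru h3 hcol
      by_cases ej : j' = 1
      · subst ej
        have h0 := hB (by omega)
        rcases Y_SW hY (PDc (S.pr h2) (by omega)) with c | c
        · exact nF c.2.2.2.1 h3 (by omega)
        · exact pF c.1 h0 (by omega)
      · have h4 := hr (y+j'-2) (by omega) (by omega)
        rcases Y_SW hY (PDc (hcol (y+j'-1) (by omega) (by omega)) (by omega)) with c | c
        · by_cases e2 : j' = 2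
          · exact pF c.1 h1 (by omega)
          · exact pF c.2.1 (hr (y+j'-3) (by omega) (by omega)) (by omega)
        · exact pF c.2.2.1 h4 (by omega)
    by_contra e
    exact S.dga (by omega) (by omega) nV (nb (by omega)) (.inr yR) dJ

/-- Opposite quadrants, representative 2. -/
theorem opp2 {x y i' j' : ℤ} (h1 : S.N x (y+1) x y) (h2 : S.N x y (x+1) y)
    (hi' : 1 ≤ i') (hj' : 1 ≤ j')
    (hJ : ∀ m n, x + 1 ≤ m → m < x + 1 + i' → y + 1 - j' ≤ n → n < y + 1 → PD S.N m n) :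
    S.dg (x+1) (y+1-j') (x+1+i') (y+1) := by
  obtain ⟨_, _, c, d, e, f⟩ := free2 h1 h2 (k := x+1+i') (by omega) (fun t ht ht' => by
        by_cases e : t = x
        · subst e; exact S.pl h2
        · exact hJ _ _ (by omega) (by omega) (by omega) (by omega))
  by_cases ej : j' = 1
  · subst ej
    simp only [add_sub_cancel_right]
    exact S.dgf (by omega) (by omega) c f d e
  have h3 : S.N (x+1) y (x+1) (y-1) := by
    rcases S.t1 (S.pr h2) (hJ (x+1) (y-1) (by omega) (by omega) (by omega) (by omega)) (by simp [AdjD]) with h | h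
    · exact h
    · exact (pF h2 h (by omega)).elim
  have hcol : ∀ t, y + 1 - j' ≤ t → t ≤ y → PD S.N (x+1) t := fun t ht ht' =>
        hJ _ _ (by omega) (by omega) (by omega) (by omega)
  have hr := rd h3 hcol
  have h4 := hr (y+2-j') (by omega) (by omega)
  refine S.dgf (by omega) (by omega) ?_ f d ?_
  · intro hY
    rcases Y_NE hY (hcol _ le_rfl (by omega)) with c | c
    · exact pF c.2.2.1 h4 (by omega)
    · by_cases e2 : j' = 2
      · exact pF c.2.1 h2 (by omega)
      · exact pF c.2.1 (hr (y+3-j') (by omega) (by omega)) (by omega)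
  · have ei : i' = 1 := by
      by_contra e
      exact kF h2 h3 (hJ (x+2) y (by omega) (by omega) (by omega) (by omega)) (by simp only [AdjD]; omega)
    subst ei
    intro hY
    rcases Y_NW hY (PDc (hcol _ le_rfl (by omega)) (by omega)) with c | c | c | c
    · by_cases e2 : j' = 2
      · exact pF c.1 h2 (by omega)
      · exact pF c.1 (hr (y+3-j') (by omega) (by omega)) (by omega)
    · exact pF c.2.1 h4 (by omega)
    · exact pF c.2.2.2.1 h4 (by omega)
    · exact pF c.2.2.2.1 h4 (by omega)

end Sys

namespace Sys
variable {S : Sys}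

def sq (S : Sys) (vx vy px py : ℤ) : Prop := vx ≠ px ∧ vy ≠ py ∧
  ∀ m n, min vx px ≤ m → m < max vx px → min vy py ≤ n → n < max vy py → PD S.N m n

def dgb (S : Sys) (a b c d : ℤ) : Prop := S.dg (min a c) (min b d) (max a c) (max b d)

def Led (S : Sys) (vx vy px py : ℤ) : Prop :=
  sq S vx vy px py ∧ ((vx < px ↔ vy < py) ↔ dgb S vx vy px py)

theorem PDtr {a b : ℤ} : PD S.tr.N a b ↔ PD S.N b a :=
  ⟨fun ⟨e, f, h⟩ => ⟨f, e, h⟩, fun ⟨e, f, h⟩ => ⟨f, e, h⟩⟩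

theorem PDro {a b : ℤ} : PD S.ro.N a b ↔ PD S.N (-1-a) (-1-b) :=
  ⟨fun ⟨e, f, h⟩ => ⟨_, _, h⟩, fun ⟨e, f, h⟩ => ⟨-1-e, -1-f, by
    show S.N _ _ _ _
    simpa using h⟩⟩

theorem sq_tr {a b c d : ℤ} (h : sq S a b c d) : sq S.tr b a d c :=
  ⟨h.2.1, h.1, fun m n h1 h2 h3 h4 => PDtr.2 (h.2.2 n m h3 h4 h1 h2)⟩

theorem sq_ro {a b c d : ℤ} (h : sq S a b c d) : sq S.ro (-a) (-b) (-c) (-d) :=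
  ⟨by have := h.1; omega, by have := h.2.1; omega, fun m n h1 h2 h3 h4 =>
    PDro.2 (h.2.2 _ _ (by omega) (by omega) (by omega) (by omega))⟩

theorem dgb_tr {a b c d : ℤ} : dgb S.tr a b c d ↔ dgb S b a d c := Iff.rfl

theorem dgb_ro {a b c d : ℤ} : dgb S.ro (-a) (-b) (-c) (-d) ↔ dgb S a b c d := by
  show S.dg _ _ _ _ ↔ S.dg _ _ _ _
  rw [show -max (-a) (-c) = min a c by omega, show -max (-b) (-d) = min b d by omega,
    show -min (-a) (-c) = max a c by omega, show -min (-b) (-d) = max b d by omega]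

theorem dgb_x {a b c d : ℤ} : dgb S a b c d ↔ dgb S c b a d := by
  simp only [dgb, min_comm a c, max_comm a c]

theorem dgb_y {a b c d : ℤ} : dgb S a b c d ↔ dgb S a d c b := by
  simp only [dgb, min_comm b d, max_comm b d]

theorem Led_tr {a b c d : ℤ} (h : Led S a b c d) : Led S.tr b a d c :=
  ⟨sq_tr h.1, by rw [dgb_tr, ← h.2]; tauto⟩

theorem Led_ro {a b c d : ℤ} (h : Led S a b c d) : Led S.ro (-a) (-b) (-c) (-d) :=
  ⟨sq_ro h.1, by
    rw [dgb_ro, ← h.2]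
    have := h.1.1
    have := h.1.2.1
    omega⟩

def Cor (S : Sys) (vx vy α γ k h : ℤ) : Prop :=
  (dgb S α vy k γ ↔ dgb S vx vy k γ) ∨ (dgb S vx h α γ ↔ dgb S vx h α vy)

theorem Cor_tr {vx vy α γ k h : ℤ} (H : Cor S.tr vy vx γ α h k) : Cor S vx vy α γ k h := by
  simp only [Cor, dgb_tr] at *
  rw [dgb_y (b := γ), dgb_y (a := vx) (b := vy), dgb_x (a := k), dgb_x (a := k)] at H
  exact H.symm

theorem Cor_ro {vx vy α γ k h : ℤ} (H : Cor S.ro (-vx) (-vy) (-α) (-γ) (-k) (-h)) :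
    Cor S vx vy α γ k h := by
  simp only [Cor, dgb_ro] at *
  exact H

/-- orientation dichotomy -/
theorem orient {a b c d e f : ℤ} (hB : PD S.N a b) (hC : PD S.N c d) (hD : PD S.N e f)
    (h1 : AdjD a b c d) (h2 : AdjD c d e f) (hne : ¬ (a = e ∧ b = f)) :
    (S.N a b c d ∧ S.N c d e f) ∨ (S.N e f c d ∧ S.N c d a b) := by
  rcases S.t1 hB hC h1 with u | u <;> rcases S.t1 hC hD h2 with v | v
  · exact .inl ⟨u, v⟩
  · exact (pF u v (by omega)).elim
  · exact (nF u v (by omega)).elim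
  · exact .inr ⟨v, u⟩

theorem cor_ul0 {x y k h : ℤ} (hk : x + 1 < k) (hh : h < y)
    (h1 : sq S x y k (y+1)) (h2 : sq S (x+1) h x (y+1))
    (o1 : S.N x (y-1) x y) (o2 : S.N x y (x+1) y) : Cor S (x+1) y x (y+1) k h := by
  have := corner1 o1 o2 (k := k) (h := h) (by omega) (by omega)
    (fun t _ _ => h1.2.2 t y (by omega) (by omega) (by omega) (by omega))
    (fun t _ _ => h2.2.2 x t (by omega) (by omega) (by omega) (by omega))
  simp only [Cor, dgb]
  rwa [min_eq_left (by omega : x ≤ k), min_eq_left (by omega : y ≤ y+1), max_eq_right (by omega : x ≤ k),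
    max_eq_right (by omega : y ≤ y+1), min_eq_left (by omega : x + 1 ≤ k), max_eq_right (by omega : x + 1 ≤ k),
    min_eq_right (by omega : x ≤ x + 1), max_eq_left (by omega : x ≤ x + 1), min_eq_left (by omega : h ≤ y+1),
    max_eq_right (by omega : h ≤ y+1), min_eq_left (by omega : h ≤ y), max_eq_right (by omega : h ≤ y)]

theorem cor_ll0 {x y k h : ℤ} (hk : x + 1 < k)
    (h1 : sq S x (y+1) k y) 
    (o1 : S.N x (y+1) x y) (o2 : S.N x y (x+1) y) : Cor S (x+1) (y+1) x y k h := by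
  have := corner2 o1 o2 (k := k) (by omega) 
    (fun t _ _ => h1.2.2 t y (by omega) (by omega) (by omega) (by omega))
  left
  simp only [dgb]
  rwa [min_eq_left (by omega : x ≤ k), min_eq_right (by omega : y ≤ y+1), max_eq_right (by omega : x ≤ k),
    max_eq_left (by omega : y ≤ y+1), min_eq_left (by omega : x + 1 ≤ k), max_eq_right (by omega : x + 1 ≤ k)]

theorem cor_ul {x y k h : ℤ} (hk : x + 1 < k) (hh : h < y)
    (h1 : sq S x y k (y+1)) (h2 : sq S (x+1) h x (y+1)) : Cor S (x+1) y x (y+1) k h := by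
  rcases orient (h2.2.2 x (y-1) (by omega) (by omega) (by omega) (by omega))
    (h2.2.2 x y (by omega) (by omega) (by omega) (by omega))
    (h1.2.2 (x+1) y (by omega) (by omega) (by omega) (by omega)) (by simp [AdjD]) (by simp [AdjD])
    (by omega) with ⟨o1, o2⟩ | ⟨o1, o2⟩
  · exact cor_ul0 hk hh h1 h2 o1 o2
  · apply Cor_tr
    apply Cor_ro
    have := cor_ul0 (S := S.tr.ro) (x := -(y+1)) (y := -(x+1)) (k := -h) (h := -k) (by omega) (by omega)
      (by have := sq_ro (sq_tr h2)
          simp only [sq] at *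
          refine ⟨by omega, by omega, fun m n _ _ _ _ => this.2.2 m n (by omega) (by omega) (by omega) (by omega)⟩)
      (by have := sq_ro (sq_tr h1)
          simp only [sq] at *
          refine ⟨by omega, by omega, fun m n _ _ _ _ => this.2.2 m n (by omega) (by omega) (by omega) (by omega)⟩)
      (by show S.N _ _ _ _; exact Nc o1 (by omega))
      (by show S.N _ _ _ _; exact Nc o2 (by omega))
    convert this using 1 <;> ring

theorem cor_ll {x y k h : ℤ} (hk : x + 1 < k) (hh : y + 1 < h)
    (h1 : sq S x (y+1) k y) (h2 : sq S (x+1) h x y) : Cor S (x+1) (y+1) x y k h := by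
  rcases orient (h2.2.2 x (y+1) (by omega) (by omega) (by omega) (by omega))
    (h2.2.2 x y (by omega) (by omega) (by omega) (by omega))
    (h1.2.2 (x+1) y (by omega) (by omega) (by omega) (by omega)) (by simp [AdjD]) (by simp [AdjD])
    (by omega) with ⟨o1, o2⟩ | ⟨o1, o2⟩
  · exact cor_ll0 hk h1 o1 o2
  · apply Cor_tr
    exact cor_ll0 (S := S.tr) hh
      (by have := sq_tr h2
          simp only [sq] at *
          refine ⟨by omega, by omega, fun m n _ _ _ _ => this.2.2 m n (by omega) (by omega) (by omega) (by omega)⟩) o1 o2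

theorem corner {vx vy α γ k h : ℤ} 
    (ha : (α = vx + 1 ∧ k < vx) ∨ (α = vx - 1 ∧ vx < k))
    (hg : (γ = vy + 1 ∧ h < vy) ∨ (γ = vy - 1 ∧ vy < h))
    (h1 : sq S α vy k γ) (h2 : sq S vx h α γ) : Cor S vx vy α γ k h := by
  rcases ha with ⟨rfl, ha⟩ | ⟨rfl, ha⟩ <;> rcases hg with ⟨rfl, hg⟩ | ⟨rfl, hg⟩
  · apply Cor_ro
    have := cor_ll (S := S.ro) (x := -(vx+1)) (y := -(vy+1)) (k := -k) (h := -h) (by omega) (by omega)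
      (by convert sq_ro h1 using 1; ring) (by convert sq_ro h2 using 1; ring)
    convert this using 1 <;> ring
  · apply Cor_ro
    have := cor_ul (S := S.ro) (x := -(vx+1)) (y := -vy) (k := -k) (h := -h) (by omega) (by omega)
      (by convert sq_ro h1 using 1; ring) (by convert sq_ro h2 using 1 <;> ring)
    convert this using 1 <;> ring
  · have := cor_ul (S := S) (x := vx-1) (y := vy) (k := k) (h := h) (by omega) (by omega)
      h1 (by convert h2 using 1; ring)
    convert this using 1; ring
  · have := cor_ll (S := S) (x := vx-1) (y := vy-1) (k := k) (h := h) (by omega) (by omega)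
      (by convert h1 using 1; ring) (by convert h2 using 1; ring)
    convert this using 1 <;> ring

end Sys

namespace Sys
variable {S : Sys}

theorem opp_ul0 {x y px py qx qy : ℤ} (hp : px < x + 1 ∧ x + 1 < qx) (hq : py < y ∧ y < qy)
    (l1 : Led S (x+1) y px py) (l2 : Led S (x+1) y qx qy)
    (o1 : S.N x (y-1) x y) (o2 : S.N x y (x+1) y) : px = x ∧ qy = y + 1 := by
  have d1 : dgb S (x+1) y px py := l1.2.1 (by omega)
  have d2 : dgb S (x+1) y qx qy := l2.2.1 (by omega)
  simp only [dgb] at d1 d2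
  rw [min_eq_right (by omega), min_eq_right (by omega), max_eq_left (by omega), max_eq_left (by omega)] at d1
  rw [min_eq_left (by omega), min_eq_left (by omega), max_eq_right (by omega), max_eq_right (by omega)] at d2
  have := opp1 (i := x + 1 - px) (j := y - py) (i' := qx - (x+1)) (j' := qy - y) o1 o2
    (by omega) (by omega) (by omega) (by omega)
    (fun m n _ _ _ _ => l1.1.2.2 m n (by omega) (by omega) (by omega) (by omega))
    (fun m n _ _ _ _ => l2.1.2.2 m n (by omega) (by omega) (by omega) (by omega))
    (by convert d1 using 1 <;> ring) (by convert d2 using 1 <;> ring)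
  omega

theorem opp_ll0 {x y qx qy : ℤ} (hp : x + 1 < qx) (hq : qy < y + 1)
    (l2 : Led S (x+1) (y+1) qx qy)
    (o1 : S.N x (y+1) x y) (o2 : S.N x y (x+1) y) : False := by
  have := opp2 (i' := qx - (x+1)) (j' := y + 1 - qy) o1 o2 (by omega) (by omega)
    (fun m n _ _ _ _ => l2.1.2.2 m n (by omega) (by omega) (by omega) (by omega))
  have d2 : dgb S (x+1) (y+1) qx qy := by
    simp only [dgb]
    rw [min_eq_left (by omega), min_eq_right (by omega), max_eq_right (by omega), max_eq_left (by omega)]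
    convert this using 1 <;> ring
  have := l2.2.2 d2
  omega

theorem opp_ul {x y px py qx qy : ℤ} (hp : px < x + 1 ∧ x + 1 < qx) (hq : py < y ∧ y < qy)
    (hc : PD S.N x y)
    (l1 : Led S (x+1) y px py) (l2 : Led S (x+1) y qx qy) : px = x ∧ qy = y + 1 := by
  rcases orient (l1.1.2.2 x (y-1) (by omega) (by omega) (by omega) (by omega)) hc
    (l2.1.2.2 (x+1) y (by omega) (by omega) (by omega) (by omega)) (by simp [AdjD]) (by simp [AdjD])
    (by omega) with ⟨o1, o2⟩ | ⟨o1, o2⟩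
  · exact opp_ul0 hp hq l1 l2 o1 o2
  · have := opp_ul0 (S := S.tr.ro) (x := -(y+1)) (y := -(x+1)) (px := -qy) (py := -qx) (qx := -py) (qy := -px)
      (by omega) (by omega) (by convert Led_ro (Led_tr l2) using 1; ring)
      (by convert Led_ro (Led_tr l1) using 1; ring)
      (by show S.N _ _ _ _; exact Nc o1 (by omega))
      (by show S.N _ _ _ _; exact Nc o2 (by omega))
    omega

theorem opp_ll {x y px py qx qy : ℤ} (hp : px < x + 1 ∧ x + 1 < qx) (hq : y + 1 < py ∧ qy < y + 1)
    (hc : PD S.N x y)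
    (l1 : Led S (x+1) (y+1) px py) (l2 : Led S (x+1) (y+1) qx qy) : False := by
  rcases orient (l1.1.2.2 x (y+1) (by omega) (by omega) (by omega) (by omega)) hc
    (l2.1.2.2 (x+1) y (by omega) (by omega) (by omega) (by omega)) (by simp [AdjD]) (by simp [AdjD])
    (by omega) with ⟨o1, o2⟩ | ⟨o1, o2⟩
  · exact opp_ll0 hp.2 hq.2 l2 o1 o2
  · exact opp_ll0 (S := S.tr) hq.1 hp.1 (Led_tr l1) o1 o2

theorem opp {vx vy px py qx qy α γ : ℤ}
    (ha : (α = vx - 1 ∧ px < vx ∧ vx < qx) ∨ (α = vx + 1 ∧ vx < px ∧ qx < vx))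
    (hg : (γ = vy + 1 ∧ py < vy ∧ vy < qy) ∨ (γ = vy - 1 ∧ vy < py ∧ qy < vy))
    (hc : sq S vx vy α γ) (l1 : Led S vx vy px py) (l2 : Led S vx vy qx qy) : px = α ∧ qy = γ := by
  rcases ha with ⟨rfl, ha⟩ | ⟨rfl, ha⟩ <;> rcases hg with ⟨rfl, hg⟩ | ⟨rfl, hg⟩
  · exact opp_ul (S := S) (x := vx-1) (y := vy) (px := px) (py := py) (qx := qx) (qy := qy) (by omega) hg
      (hc.2.2 _ _ (by omega) (by omega) (by omega) (by omega))
      (by convert l1 using 1; ring) (by convert l2 using 1; ring)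
  · exact (opp_ll (S := S) (x := vx-1) (y := vy-1) (px := px) (py := py) (qx := qx) (qy := qy)
      (by omega) (by omega)
      (hc.2.2 _ _ (by omega) (by omega) (by omega) (by omega))
      (by convert l1 using 1 <;> ring) (by convert l2 using 1 <;> ring)).elim
  · exact (opp_ll (S := S.ro) (x := -(vx+1)) (y := -(vy+1)) (px := -px) (py := -py) (qx := -qx) (qy := -qy)
      (by omega) (by omega)
      (PDro.2 (hc.2.2 _ _ (by omega) (by omega) (by omega) (by omega)))
      (by convert Led_ro l1 using 1 <;> ring) (by convert Led_ro l2 using 1 <;> ring)).elim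
  · have := opp_ul (S := S.ro) (x := -(vx+1)) (y := -vy) (px := -px) (py := -py) (qx := -qx) (qy := -qy)
      (by omega) (by omega)
      (PDro.2 (hc.2.2 _ _ (by omega) (by omega) (by omega) (by omega)))
      (by convert Led_ro l1 using 1; ring) (by convert Led_ro l2 using 1; ring)
    omega

theorem thin {vx vy px py : ℤ} (h : sq S vx vy px py) : (px = vx + 1 ∨ px = vx - 1) ∨ (py = vy + 1 ∨ py = vy - 1) := by
  obtain ⟨h1, h2, h3⟩ := h
  by_contra e
  refine S.nosq (x := min vx px) (y := min vy py) ?_ ?_ ?_ ?_ <;> apply h3 <;> omega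

/-- Final assembly: `Cor` gives the local confluence. -/
def Goal (S : Sys) (vx vy px py qx qy : ℤ) : Prop :=
  sq S vx py qx qy ∧ sq S qx vy px py ∧ (Led S vx py qx qy ∨ Led S qx vy px py)

theorem sq_of {a b c d a' b' c' d' a'' b'' c'' d'' : ℤ} (h : sq S a b c d) (h' : sq S a' b' c' d')
    (e : a'' ≠ c'' ∧ b'' ≠ d'') (u : ∀ m n, min a'' c'' ≤ m → m < max a'' c'' → min b'' d'' ≤ n → n < max b'' d'' →
      (min a c ≤ m ∧ m < max a c ∧ min b d ≤ n ∧ n < max b d) ∨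
      (min a' c' ≤ m ∧ m < max a' c' ∧ min b' d' ≤ n ∧ n < max b' d')) : sq S a'' b'' c'' d'' := by
  refine ⟨e.1, e.2, fun m n h1 h2 h3 h4 => ?_⟩
  rcases u m n h1 h2 h3 h4 with u | u
  · exact h.2.2 m n u.1 u.2.1 u.2.2.1 u.2.2.2
  · exact h'.2.2 m n u.1 u.2.1 u.2.2.1 u.2.2.2

set_option maxHeartbeats 1000000 in
/-- `p` wide (height 1), `q` tall (width 1), not opposite quadrants -/
theorem LC1 {vx vy px py qx qy : ℤ} (l1 : Led S vx vy px py) (l2 : Led S vx vy qx qy)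
    (hp : py = vy + 1 ∨ py = vy - 1) (hq : qx = vx + 1 ∨ qx = vx - 1)
    (nx : px ≠ qx) (ny : py ≠ qy) (no : ¬ ((vx < px ↔ qx < vx) ∧ (vy < py ↔ qy < vy))) :
    Goal S vx vy px py qx qy := by
  have n1 := l1.1.1
  have n2 := l1.1.2.1
  have n3 := l2.1.1
  have n4 := l2.1.2.1
  have s1 : sq S vx py qx qy := sq_of l1.1 l2.1 (by omega) (by omega)
  have s2 : sq S qx vy px py := sq_of l1.1 l2.1 (by omega) (by omega)
  refine ⟨s1, s2, ?_⟩
  suffices H : (dgb S qx vy px py ↔ dgb S vx vy px py) ∨ (dgb S vx py qx qy ↔ dgb S vx vy qx qy) by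
    rcases H with H | H
    · right; refine ⟨s2, ?_⟩; rw [H, ← l1.2]; omega
    · left; refine ⟨s1, ?_⟩; rw [H, ← l2.2]; omega
  by_cases c1 : vx < px ↔ vx < qx
  · by_cases c2 : vy < py ↔ vy < qy
    · have := corner (S := S) (vx := qx) (vy := py) (α := vx) (γ := vy) (k := px) (h := qy)
        (by omega) (by omega) (sq_of l1.1 l1.1 (by omega) (by omega)) (sq_of l2.1 l2.1 (by omega) (by omega))
      simp only [Cor] at this
      rw [dgb_y, dgb_y (a := qx) (b := py), dgb_x (a := qx) (b := qy), dgb_x (a := qx) (b := qy),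
        dgb_y (b := qy), dgb_y (b := qy)] at this
      exact this.imp Iff.symm Iff.symm
    · have := corner (S := S) (vx := qx) (vy := vy) (α := vx) (γ := py) (k := px) (h := qy)
        (by omega) (by omega) (sq_of l1.1 l1.1 (by omega) (by omega)) (sq_of l2.1 l1.1 (by omega) (by omega))
      simp only [Cor] at this
      rw [dgb_x (a := qx) (b := qy), dgb_x (a := qx) (b := qy),
        dgb_y (b := qy), dgb_y (b := qy)] at this
      exact this.imp Iff.symm id
  · have := corner (S := S) (vx := vx) (vy := py) (α := qx) (γ := vy) (k := px) (h := qy)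
        (by omega) (by omega) (sq_of l1.1 l2.1 (by omega) (by omega)) (sq_of l2.1 l2.1 (by omega) (by omega))
    simp only [Cor] at this
    rw [dgb_y, dgb_y (b := py), dgb_y (b := qy), dgb_y (b := qy)] at this
    exact this.imp id Iff.symm

/-- opposite quadrants with the middle cell on `q`-column side and `p`-row side. -/
theorem LC2 {vx vy px py qx qy α γ : ℤ} (l1 : Led S vx vy px py) (l2 : Led S vx vy qx qy)
    (ha : (α = vx - 1 ∧ qx < vx ∧ vx < px) ∨ (α = vx + 1 ∧ vx < qx ∧ px < vx))
    (hg : (γ = vy + 1 ∧ qy < vy ∧ vy < py) ∨ (γ = vy - 1 ∧ vy < qy ∧ py < vy))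
    (hc : sq S vx vy α γ) : Goal S vx vy px py qx qy := by
  obtain ⟨rfl, rfl⟩ := opp ha hg hc l2 l1
  have s1 : sq S vx py qx qy := sq_of hc l2.1 (by omega) (by omega)
  have s2 : sq S qx vy px py := sq_of hc l1.1 (by omega) (by omega)
  refine ⟨s1, s2, ?_⟩
  have := corner (S := S) (vx := vx) (vy := vy) (α := qx) (γ := py) (k := px) (h := qy)
        (by omega) (by omega) s2 (sq_of s1 s1 (by omega) (by omega))
  simp only [Cor] at this
  rw [dgb_y (b := qy), dgb_y (b := qy)] at this
  rcases this with H | H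
  · right; refine ⟨s2, ?_⟩; rw [H, ← l1.2]; omega
  · left; refine ⟨s1, ?_⟩; rw [H, ← l2.2]; omega

theorem midA {x y : ℤ} (h1 : PD S.N x y) (h2 : PD S.N (x+1) (y+1)) : PD S.N x (y+1) ∨ PD S.N (x+1) y := by
  obtain ⟨a, b, h⟩ := S.tA h1 h2
  rcases h with ⟨u, v⟩ | ⟨u, v⟩
  · have a1 := S.adj u; have a2 := S.adj v
    simp only [AdjD] at a1 a2
    have : (a = x ∧ b = y + 1) ∨ (a = x + 1 ∧ b = y) := by omega
    rcases this with ⟨rfl, rfl⟩ | ⟨rfl, rfl⟩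
    · exact .inl (S.pr u)
    · exact .inr (S.pr u)
  · have a1 := S.adj u; have a2 := S.adj v
    simp only [AdjD] at a1 a2
    have : (a = x ∧ b = y + 1) ∨ (a = x + 1 ∧ b = y) := by omega
    rcases this with ⟨rfl, rfl⟩ | ⟨rfl, rfl⟩
    · exact .inl (S.pr u)
    · exact .inr (S.pr u)

theorem midD {x y : ℤ} (h1 : PD S.N (x+1) y) (h2 : PD S.N x (y+1)) : PD S.N x y ∨ PD S.N (x+1) (y+1) := by
  obtain ⟨a, b, h⟩ := S.tD h1 h2
  rcases h with ⟨u, v⟩ | ⟨u, v⟩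
  · have a1 := S.adj u; have a2 := S.adj v
    simp only [AdjD] at a1 a2
    have : (a = x ∧ b = y) ∨ (a = x + 1 ∧ b = y + 1) := by omega
    rcases this with ⟨rfl, rfl⟩ | ⟨rfl, rfl⟩
    · exact .inl (S.pr u)
    · exact .inr (S.pr u)
  · have a1 := S.adj u; have a2 := S.adj v
    simp only [AdjD] at a1 a2
    have : (a = x ∧ b = y) ∨ (a = x + 1 ∧ b = y + 1) := by omega
    rcases this with ⟨rfl, rfl⟩ | ⟨rfl, rfl⟩
    · exact .inl (S.pr u)
    · exact .inr (S.pr u)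

theorem sq_cell {vx vy α γ c d : ℤ} (h : PD S.N c d) (ha : (α = vx + 1 ∧ c = vx) ∨ (α = vx - 1 ∧ c = α))
    (hg : (γ = vy + 1 ∧ d = vy) ∨ (γ = vy - 1 ∧ d = γ)) : sq S vx vy α γ :=
  ⟨by omega, by omega, fun m n _ _ _ _ => PDc h (by omega)⟩

theorem LC {vx vy px py qx qy : ℤ} (l1 : Led S vx vy px py) (l2 : Led S vx vy qx qy)
    (nx : px ≠ qx) (ny : py ≠ qy) : Goal S vx vy px py qx qy ∨ Goal S vx vy qx qy px py := by
  have n1 := l1.1.1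
  have n2 := l1.1.2.1
  have n3 := l2.1.1
  have n4 := l2.1.2.1
  have key := l1.1.2.2
  have key' := l2.1.2.2
  by_cases no : (vx < px ↔ qx < vx) ∧ (vy < py ↔ qy < vy)
  · by_cases a : vx < px <;> by_cases b : vy < py
    · rcases midA (S := S) (x := vx - 1) (y := vy - 1) (key' _ _ (by omega) (by omega) (by omega) (by omega))
        (key _ _ (by omega) (by omega) (by omega) (by omega)) with h | h
      · exact .inl (LC2 (α := vx - 1) (γ := vy + 1) l1 l2 (by omega) (by omega) (sq_cell h (by omega) (by omega)))
      · exact .inr (LC2 (α := vx + 1) (γ := vy - 1) l2 l1 (by omega) (by omega) (sq_cell h (by omega) (by omega)))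
    · rcases midD (S := S) (x := vx - 1) (y := vy - 1) (key _ _ (by omega) (by omega) (by omega) (by omega))
        (key' _ _ (by omega) (by omega) (by omega) (by omega)) with h | h
      · exact .inl (LC2 (α := vx - 1) (γ := vy - 1) l1 l2 (by omega) (by omega) (sq_cell h (by omega) (by omega)))
      · exact .inr (LC2 (α := vx + 1) (γ := vy + 1) l2 l1 (by omega) (by omega) (sq_cell h (by omega) (by omega)))
    · rcases midD (S := S) (x := vx - 1) (y := vy - 1) (key' _ _ (by omega) (by omega) (by omega) (by omega))
        (key _ _ (by omega) (by omega) (by omega) (by omega)) with h | h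
      · exact .inr (LC2 (α := vx - 1) (γ := vy - 1) l2 l1 (by omega) (by omega) (sq_cell h (by omega) (by omega)))
      · exact .inl (LC2 (α := vx + 1) (γ := vy + 1) l1 l2 (by omega) (by omega) (sq_cell h (by omega) (by omega)))
    · rcases midA (S := S) (x := vx - 1) (y := vy - 1) (key _ _ (by omega) (by omega) (by omega) (by omega))
        (key' _ _ (by omega) (by omega) (by omega) (by omega)) with h | h
      · exact .inr (LC2 (α := vx - 1) (γ := vy + 1) l2 l1 (by omega) (by omega) (sq_cell h (by omega) (by omega)))
      · exact .inl (LC2 (α := vx + 1) (γ := vy - 1) l1 l2 (by omega) (by omega) (sq_cell h (by omega) (by omega)))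
  · have t1 := thin l1.1
    have t2 := thin l2.1
    have C : ((py = vy + 1 ∨ py = vy - 1) ∧ (qx = vx + 1 ∨ qx = vx - 1)) ∨
        ((qy = vy + 1 ∨ qy = vy - 1) ∧ (px = vx + 1 ∨ px = vx - 1)) := by
      by_contra hC
      by_cases c1 : vx < px ↔ vx < qx
      · by_cases c2 : vy < py ↔ vy < qy
        · omega
        · have := thin (sq_of (S := S) l1.1 l2.1 (a'' := (if vx < px then min px qx else max px qx)) (b'' := py) (c'' := vx) (d'' := qy)
            (by split_ifs <;> omega) (by split_ifs <;> omega))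
          split_ifs at this <;> omega
      · have := thin (sq_of (S := S) l1.1 l2.1 (a'' := px) (b'' := (if vy < py then min py qy else max py qy)) (c'' := qx) (d'' := vy)
            (by split_ifs <;> omega) (by split_ifs <;> omega))
        split_ifs at this <;> omega
    rcases C with C | C
    · exact .inl (LC1 l1 l2 C.1 C.2 nx ny no)
    · exact .inr (LC1 l2 l1 C.1 C.2 nx.symm ny.symm (by omega))

end Sys


theorem exists_nf {α : Type*} (R : α → α → Prop) (φ : α → ℕ) (hφ : ∀ u u', R u u' → φ u' < φ u)
    (hc : ∀ u u1 u2, R u u1 → R u u2 → ∃ w, φ w < φ u ∧ (u1 = w ∨ R u1 w ∨ R w u1) ∧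
      (u2 = w ∨ R u2 w ∨ R w u2)) :
    ∃ nf : α → α, (∀ u, Relation.ReflTransGen R u (nf u)) ∧ ∀ u u', R u u' → nf u = nf u' := by
  classical
  have ex : ∀ n u, φ u = n → ∃ v, Relation.ReflTransGen R u v ∧ ∀ w, ¬ R v w := by
    intro n
    induction n using Nat.strong_induction_on with
    | _ n ih =>
      intro u hu
      by_cases h : ∃ w, R u w
      · obtain ⟨w, hw⟩ := h
        obtain ⟨v, h1, h2⟩ := ih _ (hu ▸ hφ u w hw) w rfl
        exact ⟨v, .head hw h1, h2⟩
      · exact ⟨u, .refl, fun w hw => h ⟨w, hw⟩⟩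
  choose nf h1 h2 using fun u => ex _ u rfl
  have un : ∀ n u, φ u = n → ∀ v, Relation.ReflTransGen R u v → (∀ w, ¬ R v w) → v = nf u := by
    intro n
    induction n using Nat.strong_induction_on with
    | _ n ih =>
      intro u hu v hv hv'
      have st : ∀ x y, φ x < n → φ y < n → (x = y ∨ R x y ∨ R y x) → nf x = nf y := by
        rintro x y hx hy (rfl | h | h)
        · rfl
        · exact (ih _ hx x rfl _ (.head h (h1 y)) (h2 y)).symm
        · exact (ih _ hy y rfl _ (.head h (h1 x)) (h2 x))
      rcases Relation.ReflTransGen.cases_head hv with e | ⟨u1, r1, s1⟩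
      · subst e
        rcases Relation.ReflTransGen.cases_head (h1 u) with e | ⟨u2, r2, s2⟩
        · exact e
        · exact (hv' _ r2).elim
      · rcases Relation.ReflTransGen.cases_head (h1 u) with e | ⟨u2, r2, s2⟩
        · exact (h2 u u1 (by rw [← e]; exact r1)).elim
        · obtain ⟨w, hw, c1, c2⟩ := hc u u1 u2 r1 r2
          have l1 := hφ _ _ r1
          have l2 := hφ _ _ r2
          rw [hu] at hw l1 l2
          rw [ih _ l1 u1 rfl v s1 hv', ih _ l2 u2 rfl _ s2 (h2 u), st _ _ l1 hw c1, st _ _ l2 hw c2]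
  exact ⟨nf, h1, fun u u' h => (un _ u rfl _ (.head h (h1 u')) (h2 u')).symm⟩

/-- Data for the rewriting system. -/
structure RS where
  Sq : Pt → Pt → Prop
  Ld : Pt → Pt → Prop
  rk : Pt → ℕ
  ldsq : ∀ {v p}, Ld v p → Sq v p
  ldsy : ∀ {v p}, Ld v p → Ld p v
  nex : ∀ {v p}, Sq v p → v.1 ≠ p.1
  ney : ∀ {v p}, Sq v p → v.2 ≠ p.2
  tog : ∀ {v p}, Sq v p → Ld v p ∨ Ld (v.1, p.2) (p.1, v.2)
  mx : ∀ {v p}, Ld v p → (rk (v.1, p.2) < rk v ∧ rk (p.1, v.2) < rk v) ∨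
    (rk (v.1, p.2) < rk p ∧ rk (p.1, v.2) < rk p)
  sx : ∀ {v p q}, Ld v p → Ld v q → p.1 = q.1 → p.2 ≠ q.2 → Sq (v.1, p.2) q
  sy : ∀ {v p q}, Ld v p → Ld v q → p.2 = q.2 → p.1 ≠ q.1 → Sq (p.1, v.2) q
  lc : ∀ {v p q}, Ld v p → Ld v q → p.1 ≠ q.1 → p.2 ≠ q.2 →
    (Sq (v.1, p.2) q ∧ Sq (q.1, v.2) p ∧ (Ld (v.1, p.2) q ∨ Ld (q.1, v.2) p)) ∨
    (Sq (v.1, q.2) p ∧ Sq (p.1, v.2) q ∧ (Ld (v.1, q.2) p ∨ Ld (p.1, v.2) q))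

namespace RS
open Finsupp
variable (T : RS)

noncomputable def m2 (v p : Pt) : Pt →₀ ℕ := single v 1 + single p 1

def R (u u' : Pt →₀ ℕ) : Prop := ∃ v p m, T.Ld v p ∧ u = m2 v p + m ∧ u' = m2 (v.1, p.2) (p.1, v.2) + m

noncomputable def φ (u : Pt →₀ ℕ) : ℕ := u.sum fun z k => k * 3 ^ T.rk z

theorem φ_add (u v) : T.φ (u + v) = T.φ u + T.φ v := by
  unfold φ
  exact Finsupp.sum_add_index' (by simp) (by intros; ring)

theorem φ_m2 (v p) : T.φ (m2 v p) = 3 ^ T.rk v + 3 ^ T.rk p := by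
  rw [m2, φ_add]; simp [φ]

theorem φR {u u'} (h : T.R u u') : T.φ u' < T.φ u := by
  obtain ⟨v, p, m, h, rfl, rfl⟩ := h
  rw [φ_add, φ_add, φ_m2, φ_m2]
  have key : ∀ a b c d : ℕ, a < c → b < c → 3 ^ a + 3 ^ b < 3 ^ c + 3 ^ d := by
    intro a b c d h1 h2
    obtain ⟨c, rfl⟩ : ∃ c', c = c' + 1 := ⟨c - 1, by omega⟩
    have := Nat.pow_le_pow_right (n := 3) (by norm_num) (show a ≤ c by omega)
    have := Nat.pow_le_pow_right (n := 3) (by norm_num) (show b ≤ c by omega)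
    have : 0 < 3 ^ c := by positivity
    have : 0 < 3 ^ d := by positivity
    rw [pow_succ]; omega
  rcases T.mx h with h | h
  · have := key _ _ _ (T.rk p) h.1 h.2; omega
  · have := key _ _ _ (T.rk v) h.1 h.2; omega

theorem m2c (v p) : m2 v p = m2 p v := add_comm _ _

theorem Rtog {v p : Pt} (h : T.Sq v p) (m) : T.R (m2 v p + m) (m2 (v.1, p.2) (p.1, v.2) + m) ∨
    T.R (m2 (v.1, p.2) (p.1, v.2) + m) (m2 v p + m) := by
  rcases T.tog h with h | h
  · exact .inl ⟨v, p, m, h, rfl, rfl⟩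
  · exact .inr ⟨_, _, m, h, rfl, rfl⟩

theorem split {a b : Pt} {m m' : Pt →₀ ℕ} (hab : a ≠ b) (h : single a 1 + m = single b 1 + m') :
    ∃ m0, m = single b 1 + m0 ∧ m' = single a 1 + m0 := by
  have h1 : single b 1 ≤ m := by
    rw [Finsupp.single_le_iff]
    have := DFunLike.congr_fun h b
    simp [hab] at this
    omega
  obtain ⟨m0, rfl⟩ := exists_add_of_le h1
  refine ⟨m0, rfl, ?_⟩
  rw [add_left_comm] at h
  exact (add_left_cancel h).symm

/-- shared variable -/
theorem share {v p q : Pt} {m m' : Pt →₀ ℕ} (h1 : T.Ld v p) (h2 : T.Ld v q) (e : m2 v p + m = m2 v q + m') :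
    ∃ w, T.φ w < T.φ (m2 v p + m) ∧
      (m2 (v.1, p.2) (p.1, v.2) + m = w ∨ T.R (m2 (v.1, p.2) (p.1, v.2) + m) w ∨ T.R w (m2 (v.1, p.2) (p.1, v.2) + m)) ∧
      (m2 (v.1, q.2) (q.1, v.2) + m' = w ∨ T.R (m2 (v.1, q.2) (q.1, v.2) + m') w ∨ T.R w (m2 (v.1, q.2) (q.1, v.2) + m')) := by
  have r1 : T.R (m2 v p + m) (m2 (v.1, p.2) (p.1, v.2) + m) := ⟨v, p, m, h1, rfl, rfl⟩
  have r2 : T.R (m2 v p + m) (m2 (v.1, q.2) (q.1, v.2) + m') := ⟨v, q, m', h2, e, rfl⟩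
  have f1 := T.φR r1
  have f2 := T.φR r2
  have e' : single p 1 + m = single q 1 + m' := by
    simp only [m2, add_assoc] at e
    exact add_left_cancel e
  by_cases hpq : p = q
  · subst hpq
    have : m = m' := add_left_cancel e'
    subst this
    exact ⟨_, f1, .inl rfl, .inl rfl⟩
  obtain ⟨m0, rfl, rfl⟩ := split hpq e'
  obtain ⟨vx, vy⟩ := v
  obtain ⟨px, py⟩ := p
  obtain ⟨qx, qy⟩ := q
  simp only at *
  by_cases ex : px = qx
  · subst ex
    have ey : py ≠ qy := by rintro rfl; exact hpq rfl
    have s := T.sx h1 h2 rfl ey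
    have := T.Rtog s (single (px, vy) 1 + m0)
    refine ⟨_, f1, .inl rfl, .inr ?_⟩
    have e1 : m2 (vx, py) (px, qy) + (single (px, vy) 1 + m0) = m2 (vx, py) (px, vy) + (single (px, qy) 1 + m0) := by
      simp only [m2]; abel
    have e2 : m2 (vx, qy) (px, py) + (single (px, vy) 1 + m0) = m2 (vx, qy) (px, vy) + (single (px, py) 1 + m0) := by
      simp only [m2]; abel
    simp only [e1, e2] at this
    exact this.symm
  by_cases ey : py = qy
  · subst ey
    have s := T.sy h1 h2 rfl ex
    have := T.Rtog s (single (vx, py) 1 + m0)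
    refine ⟨_, f1, .inl rfl, .inr ?_⟩
    have e1 : m2 (px, vy) (qx, py) + (single (vx, py) 1 + m0) = m2 (vx, py) (px, vy) + (single (qx, py) 1 + m0) := by
      simp only [m2]; abel
    have e2 : m2 (px, py) (qx, vy) + (single (vx, py) 1 + m0) = m2 (vx, py) (qx, vy) + (single (px, py) 1 + m0) := by
      simp only [m2]; abel
    simp only [e1, e2] at this
    exact this.symm
  rcases T.lc h1 h2 ex ey with ⟨s1, s2, l⟩ | ⟨s1, s2, l⟩
  · refine ⟨m2 (vx, qy) (qx, py) + (single (px, vy) 1 + m0), ?_, ?_, ?_⟩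
    · rcases l with l | l
      · refine lt_trans (T.φR ⟨_, _, single (px, vy) 1 + m0, l, ?_, rfl⟩) f1
        simp only [m2]; abel
      · refine lt_trans (T.φR ⟨_, _, single (vx, qy) 1 + m0, l, ?_, ?_⟩) f2
        · simp only [m2]; abel
        · simp only [m2]; abel
    · right
      have := T.Rtog s1 (single (px, vy) 1 + m0)
      convert this using 2 <;> (simp only [m2]; abel)
    · right
      have := T.Rtog s2 (single (vx, qy) 1 + m0)
      convert this using 2 <;> (simp only [m2]; abel)
  · refine ⟨m2 (vx, py) (px, qy) + (single (qx, vy) 1 + m0), ?_, ?_, ?_⟩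
    · rcases l with l | l
      · refine lt_trans (T.φR ⟨_, _, single (qx, vy) 1 + m0, l, ?_, rfl⟩) f2
        simp only [m2]; abel
      · refine lt_trans (T.φR ⟨_, _, single (vx, py) 1 + m0, l, ?_, ?_⟩) f1
        · simp only [m2]; abel
        · simp only [m2]; abel
    · right
      have := T.Rtog s2 (single (vx, py) 1 + m0)
      convert this using 2 <;> (simp only [m2]; abel)
    · right
      have := T.Rtog s1 (single (qx, vy) 1 + m0)
      convert this using 2 <;> (simp only [m2]; abel)

theorem conf (u u1 u2) (r1 : T.R u u1) (r2 : T.R u u2) : ∃ w, T.φ w < T.φ u ∧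
    (u1 = w ∨ T.R u1 w ∨ T.R w u1) ∧ (u2 = w ∨ T.R u2 w ∨ T.R w u2) := by
  have f1 := T.φR r1
  obtain ⟨v, p, m, h, rfl, rfl⟩ := r1
  obtain ⟨v', p', m', h', e, rfl⟩ := r2
  by_cases c1 : v = v'
  · subst c1; exact T.share h h' e
  by_cases c2 : v = p'
  · subst c2
    rw [m2c v' v] at e
    rw [m2c (v'.1, v.2)]
    exact T.share h (T.ldsy h') e
  by_cases c3 : p = v'
  · subst c3
    rw [m2c v p] at e ⊢
    rw [m2c (v.1, p.2)]
    exact T.share (T.ldsy h) h' e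
  by_cases c4 : p = p'
  · subst c4
    rw [m2c v p] at e ⊢
    rw [m2c v' p] at e
    rw [m2c (v.1, p.2), m2c (v'.1, p.2)]
    exact T.share (T.ldsy h) (T.ldsy h') e
  simp only [m2, add_assoc] at e
  obtain ⟨m1, e1, e2⟩ := split c1 e
  obtain ⟨m3, rfl, rfl⟩ := split c3 e1
  obtain ⟨m4, e3, e4⟩ := split (Ne.symm c2) e2
  obtain ⟨m5, rfl, rfl⟩ := split c4 e4
  subst e3
  have r3 : T.R (m2 (v.1, p.2) (p.1, v.2) + (single v' 1 + (single p' 1 + m5)))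
      (m2 (v.1, p.2) (p.1, v.2) + (m2 (v'.1, p'.2) (p'.1, v'.2) + m5)) :=
    ⟨v', p', m2 (v.1, p.2) (p.1, v.2) + m5, h', by simp only [m2]; abel, by simp only [m2]; abel⟩
  refine ⟨_, (T.φR r3).trans ?_, .inr (.inl r3), .inr (.inl ?_)⟩
  · exact f1
  · exact ⟨v, p, m2 (v'.1, p'.2) (p'.1, v'.2) + m5, h, by simp only [m2]; abel, by simp only [m2]⟩

end RS


theorem lexLt_irrefl {po : Pt → Pt → Prop} (u : Pt →₀ ℕ) : ¬ lexLt po u u := by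
  rintro ⟨w, h, -⟩; omega

theorem lexLt_trans {po : Pt → Pt → Prop} (tr : ∀ a b c, po a b → po b c → po a c)
    (tri : ∀ a b, po a b ∨ a = b ∨ po b a) {u v x : Pt →₀ ℕ} (h1 : lexLt po u v) (h2 : lexLt po v x) :
    lexLt po u x := by
  obtain ⟨w1, a1, b1⟩ := h1
  obtain ⟨w2, a2, b2⟩ := h2
  rcases tri w1 w2 with h | h | h
  · refine ⟨w2, by rw [b1 _ h]; exact a2, fun w' h' => ?_⟩
    rw [b1 _ (tr _ _ _ h h'), b2 _ h']
  · subst h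
    exact ⟨w1, a1.trans a2, fun w' h' => by rw [b1 _ h', b2 _ h']⟩
  · refine ⟨w1, by rw [← b2 _ h]; exact a1, fun w' h' => ?_⟩
    rw [b1 _ h', b2 _ (tr _ _ _ h h')]

theorem lexLe_antisymm {po : Pt → Pt → Prop} (tr : ∀ a b c, po a b → po b c → po a c)
    (tri : ∀ a b, po a b ∨ a = b ∨ po b a) {u v : Pt →₀ ℕ} (h1 : lexLe po u v) (h2 : lexLe po v u) :
    u = v := by
  rcases h1 with h1 | h1
  · exact h1
  rcases h2 with h2 | h2
  · exact h2.symm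
  exact (lexLt_irrefl _ (lexLt_trans tr tri h1 h2)).elim

theorem minor_eq (K : Type*) [Field K] (a b : Pt) : innerMinor K a b =
    monomial (RS.m2 a b) 1 - monomial (RS.m2 (a.1, b.2) (b.1, a.2)) 1 := by
  simp [innerMinor, RS.m2, X, monomial_mul]

theorem m2_le {v p v' p' : Pt} (hne : v ≠ p) (h : RS.m2 v p ≤ RS.m2 v' p') :
    (v = v' ∧ p = p') ∨ (v = p' ∧ p = v') := by
  have h1 := h v
  have h2 := h p
  simp only [RS.m2, Finsupp.add_apply, Finsupp.single_apply] at h1 h2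
  have hne' := hne.symm
  by_cases c1 : v' = v <;> by_cases c2 : p' = v <;> by_cases c3 : v' = p <;> by_cases c4 : p' = p <;>
    simp_all

structure GBData (P : Finset Pt) (po : Pt → Pt → Prop) where
  T : RS
  irr : ∀ a, ¬ po a a
  tr : ∀ a b c, po a b → po b c → po a c
  tri : ∀ a b, po a b ∨ a = b ∨ po b a
  hsq : ∀ a b, IsInnerInterval P a b → T.Sq a b
  hsq' : ∀ v p, T.Ld v p → ∃ a b, IsInnerInterval P a b ∧
    ((RS.m2 v p = RS.m2 a b ∧ RS.m2 (v.1, p.2) (p.1, v.2) = RS.m2 (a.1, b.2) (b.1, a.2)) ∨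
     (RS.m2 v p = RS.m2 (a.1, b.2) (b.1, a.2) ∧ RS.m2 (v.1, p.2) (p.1, v.2) = RS.m2 a b))
  hmx : ∀ v p, T.Ld v p → (po (v.1, p.2) v ∧ po (p.1, v.2) v) ∨ (po (v.1, p.2) p ∧ po (p.1, v.2) p)

namespace GBData

theorem asym {P : Finset Pt} {po : Pt → Pt → Prop} (D : GBData P po) {a b : Pt} (h : po a b) :
    ¬ po b a := fun h' => D.irr _ (D.tr _ _ _ h h')

theorem step {P : Finset Pt} {po : Pt → Pt → Prop} (D : GBData P po) {u u'} (h : D.T.R u u') :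
    lexLt po u' u := by
  obtain ⟨v, p, m, h, rfl, rfl⟩ := h
  have nx := D.T.nex (D.T.ldsq h)
  have ny := D.T.ney (D.T.ldsq h)
  have nvp : v ≠ p := fun e => nx (by rw [e])
  have w1 : (v.1, p.2) ≠ v := fun e => ny (by rw [← e])
  have w2 : (v.1, p.2) ≠ p := fun e => nx (by rw [← e])
  have w3 : (p.1, v.2) ≠ v := fun e => nx (by rw [← e])
  have w4 : (p.1, v.2) ≠ p := fun e => ny (by rw [← e])
  obtain ⟨z, z1, z2, z3, z4, z5⟩ : ∃ z, po (v.1, p.2) z ∧ po (p.1, v.2) z ∧ (z = v ∨ z = p) ∧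
      ¬ po z v ∧ ¬ po z p := by
    rcases D.tri v p with t | t | t
    · refine ⟨p, ?_, ?_, .inr rfl, D.asym t, D.irr _⟩
      · exact (D.hmx _ _ h).elim (fun h => D.tr _ _ _ h.1 t) (fun h => h.1)
      · exact (D.hmx _ _ h).elim (fun h => D.tr _ _ _ h.2 t) (fun h => h.2)
    · exact (nvp t).elim
    · refine ⟨v, ?_, ?_, .inl rfl, D.irr _, D.asym t⟩
      · exact (D.hmx _ _ h).elim (fun h => h.1) (fun h => D.tr _ _ _ h.1 t)
      · exact (D.hmx _ _ h).elim (fun h => h.2) (fun h => D.tr _ _ _ h.2 t)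
  refine ⟨z, ?_, fun w hw => ?_⟩
  · rcases z3 with rfl | rfl
    · simp [RS.m2, Finsupp.single_apply, w1, w3]
    · simp [RS.m2, Finsupp.single_apply, w2, w4]
  · have e1 : (v.1, p.2) ≠ w := by rintro rfl; exact D.asym z1 hw
    have e2 : (p.1, v.2) ≠ w := by rintro rfl; exact D.asym z2 hw
    have e3 : v ≠ w := by rintro rfl; exact z4 hw
    have e4 : p ≠ w := by rintro rfl; exact z5 hw
    simp [RS.m2, e1, e2, e3, e4]

theorem steps {P : Finset Pt} {po : Pt → Pt → Prop} (D : GBData P po) {u u'}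
    (h : Relation.ReflTransGen D.T.R u u') : lexLe po u' u := by
  induction h with
  | refl => exact .inl rfl
  | tail _ h ih =>
    rcases ih with rfl | ih
    · exact .inr (D.step h)
    · exact .inr (lexLt_trans D.tr D.tri (D.step h) ih)

theorem lm {K : Type*} [Field K] {P : Finset Pt} {po : Pt → Pt → Prop} (D : GBData P po) {v p : Pt} (h : D.T.Ld v p) :
    ∃ g ∈ minorsSet K P, IsLM po g (RS.m2 v p) ∧ (g.coeff (RS.m2 v p) = 1 ∨ g.coeff (RS.m2 v p) = -1) := by
  obtain ⟨a, b, hab, e⟩ := D.hsq' v p h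
  have st := D.step ⟨v, p, 0, h, rfl, rfl⟩
  rw [add_zero, add_zero] at st
  have ne : RS.m2 v p ≠ RS.m2 (v.1, p.2) (p.1, v.2) := by
    intro e; rw [e] at st; exact lexLt_irrefl _ st
  refine ⟨_, ⟨a, b, hab, rfl⟩, ?_⟩
  rw [minor_eq]
  rcases e with ⟨e1, e2⟩ | ⟨e1, e2⟩
  · rw [← e1, ← e2]
    refine ⟨⟨?_, fun m' h' => ?_⟩, ?_⟩
    · simp [mem_support_iff, coeff_monomial, ne.symm]
    · by_cases c : m' = RS.m2 v p
      · exact .inl c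
      by_cases c' : m' = RS.m2 (v.1, p.2) (p.1, v.2)
      · exact .inr (c' ▸ st)
      simp [mem_support_iff, coeff_monomial, Ne.symm c, Ne.symm c'] at h'
    · simp [coeff_monomial, ne.symm]
  · rw [← e1, ← e2]
    refine ⟨⟨?_, fun m' h' => ?_⟩, ?_⟩
    · simp [mem_support_iff, coeff_monomial, ne.symm]
    · by_cases c : m' = RS.m2 v p
      · exact .inl c
      by_cases c' : m' = RS.m2 (v.1, p.2) (p.1, v.2)
      · exact .inr (c' ▸ st)
      simp [mem_support_iff, coeff_monomial, Ne.symm c, Ne.symm c'] at h'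
    · simp [coeff_monomial, ne.symm]

theorem supp {K : Type*} [Field K] {a b : Pt} {m} (h : m ∈ (innerMinor K a b).support) :
    m = RS.m2 a b ∨ m = RS.m2 (a.1, b.2) (b.1, a.2) := by
  rw [minor_eq] at h
  by_contra! c
  simp [mem_support_iff, coeff_monomial, Ne.symm c.1, Ne.symm c.2] at h

theorem coeffs {K : Type*} [Field K] {P : Finset Pt} {po : Pt → Pt → Prop} (D : GBData P po) {a b : Pt}
    (h : IsInnerInterval P a b) : ∃ m, IsLM po (innerMinor K a b) m ∧
      ((innerMinor K a b).coeff m = 1 ∨ (innerMinor K a b).coeff m = -1) := by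
  have main : ∀ m m' : Pt →₀ ℕ, lexLt po m' m → ∀ f : MvPolynomial Pt K, (f = monomial m 1 - monomial m' 1 ∨
      f = monomial m' 1 - monomial m 1) → IsLM po f m ∧ (f.coeff m = 1 ∨ f.coeff m = -1) := by
    intro m m' st f hf
    have ne : m' ≠ m := by rintro rfl; exact lexLt_irrefl _ st
    rcases hf with rfl | rfl <;>
    · refine ⟨⟨?_, fun m'' h' => ?_⟩, ?_⟩
      · simp [mem_support_iff, coeff_monomial, ne]
      · by_cases c : m'' = m
        · exact .inl c
        by_cases c' : m'' = m'
        · exact .inr (c' ▸ st)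
        simp [mem_support_iff, coeff_monomial, Ne.symm c, Ne.symm c'] at h'
      · simp [coeff_monomial, ne]
  rcases D.T.tog (D.hsq a b h) with l | l
  · have st := D.step ⟨_, _, 0, l, rfl, rfl⟩
    rw [add_zero, add_zero] at st
    exact ⟨_, main _ _ st _ (.inl (minor_eq _ _ _))⟩
  · have st := D.step ⟨_, _, 0, l, rfl, rfl⟩
    rw [add_zero, add_zero] at st
    exact ⟨_, main _ _ st _ (.inr (minor_eq _ _ _))⟩

theorem red {K : Type*} [Field K] {P : Finset Pt} {a b a' b' : Pt} (h : IsInnerInterval P a b)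
    (h' : IsInnerInterval P a' b') {m m' : Pt →₀ ℕ} (hm : m ∈ (innerMinor K a b).support)
    (hm' : m' ∈ (innerMinor K a' b').support) (hle : m' ≤ m) : innerMinor K a' b' = innerMinor K a b := by
  have hh := h.1
  have hh2 := h.2.1
  have hh' := h'.1
  have hh2' := h'.2.1
  have n1 : a' ≠ b' := by rintro rfl; omega
  have n2 : (a'.1, b'.2) ≠ (b'.1, a'.2) := by intro e; rw [Prod.mk.injEq] at e; omega
  have : a' = a ∧ b' = b := by
    rcases supp hm with rfl | rfl <;> rcases supp hm' with rfl | rfl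
    · have := m2_le n1 hle
      simp only [Prod.ext_iff] at *; omega
    · have := m2_le n2 hle
      simp only [Prod.ext_iff] at *; omega
    · have := m2_le n1 hle
      simp only [Prod.ext_iff] at *; omega
    · have := m2_le n2 hle
      simp only [Prod.ext_iff] at *; omega
  rw [this.1, this.2]

theorem irred {K : Type*} [Field K] {P : Finset Pt} {po : Pt → Pt → Prop} (D : GBData P po)
    {f : MvPolynomial Pt K} (hf : f ∈ polyoIdeal K P) {m0} (hm : IsLM po f m0) : ∃ w, D.T.R m0 w := by
  classical
  by_contra! hc
  obtain ⟨nf, h1, h2⟩ := exists_nf D.T.R D.T.φ (fun _ _ => D.T.φR) D.T.conf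
  let L : MvPolynomial Pt K →ₗ[K] K :=
    (basisMonomials Pt K).constr K (fun m => if nf m = m0 then (1 : K) else 0)
  have hL : ∀ m c, L (monomial m c) = if nf m = m0 then c else 0 := by
    intro m c
    have : monomial m c = c • (basisMonomials Pt K m) := by simp [smul_monomial]
    rw [this, map_smul, Module.Basis.constr_basis]
    simp
  have van : ∀ g ∈ polyoIdeal K P, ∀ q, L (q * g) = 0 := by
    intro g hg
    induction hg using Submodule.span_induction with
    | mem x hx =>
      obtain ⟨a, b, hab, rfl⟩ := hx
      intro q
      induction q using MvPolynomial.induction_on' with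
      | monomial u c =>
        rw [minor_eq, mul_sub, monomial_mul, monomial_mul, map_sub, hL, hL]
        have : nf (u + RS.m2 a b) = nf (u + RS.m2 (a.1, b.2) (b.1, a.2)) := by
          rw [add_comm u, add_comm u]
          rcases D.T.Rtog (D.hsq a b hab) u with r | r
          · exact h2 _ _ r
          · exact (h2 _ _ r).symm
        rw [this]; simp
      | add p q hp hq => rw [add_mul, map_add, hp, hq, add_zero]
    | zero => intro q; simp
    | add x y _ _ hx hy => intro q; rw [mul_add, map_add, hx, hy, add_zero]
    | smul r x _ hx => intro q; rw [smul_eq_mul, ← mul_assoc]; exact hx _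
  have e0 := van f hf 1
  rw [one_mul, f.as_sum, map_sum, Finset.sum_eq_single m0] at e0
  · have : nf m0 = m0 := by
      rcases Relation.ReflTransGen.cases_head (h1 m0) with e | ⟨w, r, _⟩
      · exact e.symm
      · exact (hc w r).elim
    rw [hL, if_pos this] at e0
    exact (mem_support_iff.1 hm.1) e0
  · intro b hb hne
    rw [hL, if_neg]
    intro e
    refine hne (lexLe_antisymm D.tr D.tri (hm.2 b hb) ?_)
    rw [← e]; exact D.steps (h1 b)
  · intro h; exact (h hm.1).elim

theorem main (K : Type*) [Field K] {P : Finset Pt} {po : Pt → Pt → Prop} (D : GBData P po) :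
    IsReducedGroebnerBasis po (minorsSet K P) (polyoIdeal K P) := by
  refine ⟨⟨rfl, le_antisymm ?_ ?_⟩, ?_, ?_⟩
  · refine Ideal.span_mono ?_
    rintro f ⟨g, hg, m, hm, rfl⟩
    exact ⟨g, Ideal.subset_span hg, m, hm, rfl⟩
  · refine Ideal.span_le.2 ?_
    rintro f ⟨g, hg, m, hm, rfl⟩
    obtain ⟨w, v, p, m', hl, rfl, rfl⟩ := D.irred hg hm
    obtain ⟨g', hg', h1, -⟩ := D.lm (K := K) hl
    have : monomial (RS.m2 v p + m') (1 : K) = monomial m' 1 * monomial (RS.m2 v p) 1 := by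
      rw [monomial_mul, add_comm, one_mul]
    rw [this]
    exact Ideal.mul_mem_left _ _ (Ideal.subset_span ⟨g', hg', _, h1, rfl⟩)
  · rintro g ⟨a, b, h, rfl⟩
    exact D.coeffs h
  · rintro g ⟨a, b, h, rfl⟩ g' ⟨a', b', h', rfl⟩ hne m hm m' hm' hle
    exact hne (red h h' hm hm'.1 hle)
end GBData


theorem Ylt_irr (Y : Set Pt) (a : Pt) : ¬ Ylt Y a a := by
  unfold Ylt lt1; intro h
  rcases h with h | h | h
  · exact h.1 h.2
  · omega
  · omega

theorem lt1_tr {a b c : Pt} (h : lt1 a b) (h' : lt1 b c) : lt1 a c := by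
  unfold lt1 at *; omega

theorem Ylt_tr (Y : Set Pt) (a b c : Pt) (h : Ylt Y a b) (h' : Ylt Y b c) : Ylt Y a c := by
  unfold Ylt at *
  have := @lt1_tr a b c
  tauto

theorem lt1_tri (a b : Pt) : lt1 a b ∨ a = b ∨ lt1 b a := by
  unfold lt1; rw [Prod.ext_iff]; omega

theorem Ylt_tri (Y : Set Pt) (a b : Pt) : Ylt Y a b ∨ a = b ∨ Ylt Y b a := by
  unfold Ylt
  have := lt1_tri a b
  tauto

/-- the largest corner is diagonal -/
def dgo (po : Pt → Pt → Prop) (a b c d : ℤ) : Prop :=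
  (po (a, d) (c, d) ∧ po (c, b) (c, d)) ∨ (po (a, d) (a, b) ∧ po (c, b) (a, b))

def NA {n : ℕ} (A : ZMod n → Pt) (a b c d : ℤ) : Prop := ∃ i, A i = (a, b) ∧ A (i + 1) = (c, d)

theorem zne {n : ℕ} (hn : 5 < n) (k : ℕ) (h0 : 0 < k) (hk : k < 6) : ((k : ℕ) : ZMod n) ≠ 0 := by
  intro h
  rw [ZMod.natCast_eq_zero_iff] at h
  have := Nat.le_of_dvd h0 h
  omega

theorem PDA {n : ℕ} (A : ZMod n → Pt) (a b : ℤ) : PD (NA A) a b ↔ ∃ i, A i = (a, b) := by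
  constructor
  · rintro ⟨c, d, i, h, -⟩; exact ⟨i, h⟩
  · rintro ⟨i, h⟩; exact ⟨_, _, i, h, rfl⟩

theorem near {n : ℕ} {A : ZMod n → Pt}
    (hd : ∀ i j : ZMod n, j ≠ i - 2 → j ≠ i - 1 → j ≠ i → j ≠ i + 1 → j ≠ i + 2 →
      cellVerts (A i) ∩ cellVerts (A j) = ∅) {i j : ZMod n} {w : Pt} (h1 : w ∈ cellVerts (A i))
    (h2 : w ∈ cellVerts (A j)) : j = i - 2 ∨ j = i - 1 ∨ j = i ∨ j = i + 1 ∨ j = i + 2 := by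
  by_contra! h
  have := hd i j h.1 h.2.1 h.2.2.1 h.2.2.2.1 h.2.2.2.2
  exact (this ▸ (show w ∈ cellVerts (A i) ∩ cellVerts (A j) from ⟨h1, h2⟩) : w ∈ (∅ : Set Pt))

theorem adj_iff (p q : Pt) : cellAdj p q ↔ AdjD p.1 p.2 q.1 q.2 := by
  obtain ⟨a, b⟩ := p
  obtain ⟨c, d⟩ := q
  simp [cellAdj, AdjD]

theorem cv_iff (w p : Pt) : w ∈ cellVerts p ↔ (w.1 = p.1 ∨ w.1 = p.1 + 1) ∧ (w.2 = p.2 ∨ w.2 = p.2 + 1) := by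
  obtain ⟨a, b⟩ := p
  obtain ⟨c, d⟩ := w
  simp [cellVerts]; tauto

/-- neighbours in the plane are near in the path -/
theorem near1 {n : ℕ} {A : ZMod n → Pt} (ha : ∀ i, cellAdj (A i) (A (i + 1)))
    (hd : ∀ i j : ZMod n, j ≠ i - 2 → j ≠ i - 1 → j ≠ i → j ≠ i + 1 → j ≠ i + 2 →
      cellVerts (A i) ∩ cellVerts (A j) = ∅) {i j : ZMod n} (h : AdjD (A i).1 (A i).2 (A j).1 (A j).2) :
    j = i + 1 ∨ i = j + 1 := by
  have sh : ∃ w, w ∈ cellVerts (A i) ∧ w ∈ cellVerts (A j) := by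
    refine ⟨(max (A i).1 (A j).1, max (A i).2 (A j).2), ?_, ?_⟩ <;>
      (rw [cv_iff]; unfold AdjD at h; dsimp only; omega)
  obtain ⟨w, h1, h2⟩ := sh
  have two : ∀ k : ZMod n, ¬ AdjD (A k).1 (A k).2 (A (k + 2)).1 (A (k + 2)).2 := by
    intro k hk
    have e : k + 2 = k + 1 + 1 := by ring
    have a1 := (adj_iff _ _).1 (ha k)
    have a2 := (adj_iff _ _).1 (ha (k + 1))
    rw [← e] at a2
    unfold AdjD at *; omega
  rcases near hd h1 h2 with e | e | e | e | e
  · have : i = j + 2 := by rw [e]; ring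
    subst this
    refine (two j ?_).elim
    unfold AdjD at *; omega
  · right; rw [e]; ring
  · subst e; unfold AdjD at h; omega
  · exact .inl e
  · subst e; exact (two i h).elim

theorem near2 {n : ℕ} {A : ZMod n → Pt} (ha : ∀ i, cellAdj (A i) (A (i + 1)))
    (hd : ∀ i j : ZMod n, j ≠ i - 2 → j ≠ i - 1 → j ≠ i → j ≠ i + 1 → j ≠ i + 2 →
      cellVerts (A i) ∩ cellVerts (A j) = ∅) {i j : ZMod n}
    (h : (A j).1 = (A i).1 + 1 ∨ (A j).1 = (A i).1 - 1) (h' : (A j).2 = (A i).2 + 1 ∨ (A j).2 = (A i).2 - 1) :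
    j = i + 1 + 1 ∨ i = j + 1 + 1 := by
  have sh : ∃ w, w ∈ cellVerts (A i) ∧ w ∈ cellVerts (A j) := by
    refine ⟨(max (A i).1 (A j).1, max (A i).2 (A j).2), ?_, ?_⟩ <;>
      (rw [cv_iff]; dsimp only; omega)
  obtain ⟨w, h1, h2⟩ := sh
  rcases near hd h1 h2 with e | e | e | e | e
  · right; rw [e]; ring
  · have : i = j + 1 := by rw [e]; ring
    subst this
    have a1 := (adj_iff _ _).1 (ha j)
    unfold AdjD at *; omega
  · subst e; omega
  · subst e
    have a1 := (adj_iff _ _).1 (ha i)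
    unfold AdjD at *; omega
  · left; rw [e]; ring

def Yset {n : ℕ} (A : ZMod n → Pt) : Set Pt := {w | YD (NA A) w.1 w.2}

def mkSys {n : ℕ} (hn : 5 < n) (A : ZMod n → Pt) (hi : Function.Injective A)
    (ha : ∀ i, cellAdj (A i) (A (i + 1)))
    (hd : ∀ i j : ZMod n, j ≠ i - 2 → j ≠ i - 1 → j ≠ i → j ≠ i + 1 → j ≠ i + 2 →
      cellVerts (A i) ∩ cellVerts (A j) = ∅) : Sys where
  N := NA A
  dg := dgo (Ylt (Yset A))
  adj := by
    rintro a b c d ⟨i, h1, h2⟩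
    have := ha i
    rw [h1, h2, adj_iff] at this
    exact this
  nu := by
    rintro a b c d c' d' ⟨i, h1, h2⟩ ⟨j, h3, h4⟩
    have : i = j := hi (h1.trans h3.symm)
    subst this
    have := h2.symm.trans h4
    simpa using this
  pu := by
    rintro a b c d c' d' ⟨i, h1, h2⟩ ⟨j, h3, h4⟩
    have : i + 1 = j + 1 := hi (h2.trans h4.symm)
    have : i = j := add_right_cancel this
    subst this
    have := h1.symm.trans h3
    simpa using this
  ne := by
    rintro a b c d ⟨i, h1, h2⟩
    exact ⟨_, _, i + 1, h2, rfl⟩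
  pe := by
    rintro a b c d ⟨i, h1, h2⟩
    exact ⟨_, _, i - 1, rfl, by rw [sub_add_cancel]; exact h1⟩
  no2 := by
    rintro a b c d ⟨i, h1, h2⟩ ⟨j, h3, h4⟩
    have e1 : i + 1 = j := hi (h2.trans h3.symm)
    have e2 : j + 1 = i := hi (h4.trans h1.symm)
    apply zne hn 2 (by norm_num) (by norm_num)
    push_cast
    linear_combination e1 + e2
  no4 := by
    rintro a b c d e f g h ⟨i, h1, h2⟩ ⟨j, h3, h4⟩ ⟨k, h5, h6⟩ ⟨l, h7, h8⟩
    have e1 : i + 1 = j := hi (h2.trans h3.symm)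
    have e2 : j + 1 = k := hi (h4.trans h5.symm)
    have e3 : k + 1 = l := hi (h6.trans h7.symm)
    have e4 : l + 1 = i := hi (h8.trans h1.symm)
    apply zne hn 4 (by norm_num) (by norm_num)
    push_cast
    linear_combination e1 + e2 + e3 + e4
  t1 := by
    rintro a b c d h1 h2 h
    obtain ⟨i, h1⟩ := (PDA _ _ _).1 h1
    obtain ⟨j, h2⟩ := (PDA _ _ _).1 h2
    rcases near1 ha hd (i := i) (j := j) (by rw [h1, h2]; exact h) with rfl | rfl
    · exact .inl ⟨_, h1, h2⟩
    · exact .inr ⟨_, h2, h1⟩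
  tA := by
    rintro x y h1 h2
    obtain ⟨i, h1⟩ := (PDA _ _ _).1 h1
    obtain ⟨j, h2⟩ := (PDA _ _ _).1 h2
    rcases near2 ha hd (i := i) (j := j) (by rw [h1, h2]; simp) (by rw [h1, h2]; simp) with rfl | rfl
    · exact ⟨_, _, .inl ⟨⟨_, h1, rfl⟩, ⟨_, rfl, h2⟩⟩⟩
    · exact ⟨_, _, .inr ⟨⟨_, h2, rfl⟩, ⟨_, rfl, h1⟩⟩⟩
  tD := by
    rintro x y h1 h2
    obtain ⟨i, h1⟩ := (PDA _ _ _).1 h1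
    obtain ⟨j, h2⟩ := (PDA _ _ _).1 h2
    rcases near2 ha hd (i := i) (j := j) (by rw [h1, h2]; simp) (by rw [h1, h2]; simp) with rfl | rfl
    · exact ⟨_, _, .inl ⟨⟨_, h1, rfl⟩, ⟨_, rfl, h2⟩⟩⟩
    · exact ⟨_, _, .inr ⟨⟨_, h2, rfl⟩, ⟨_, rfl, h1⟩⟩⟩
  dgf := by
    intro a b c d h1 h2 n1 n2 n3 n4
    left
    refine ⟨.inr (.inl ⟨n3, n2, .inl h1⟩), .inr (.inl ⟨n4, n2, .inr ⟨rfl, h2⟩⟩)⟩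
  dga := by
    intro a b c d h1 h2 n1 n2 n3 hg
    have key : ∀ u w : Pt, ¬ YD (NA A) w.1 w.2 → YD (NA A) u.1 u.2 → ¬ Ylt (Yset A) u w := by
      intro u w hw hu h
      have hw' : w ∉ Yset A := hw
      have hu' : u ∈ Yset A := hu
      unfold Ylt at h
      tauto
    rcases n3 with n3 | n3 <;> rcases hg with g | g
    · exact key _ _ n2 n3 g.1
    · exact key _ _ n1 n3 g.1
    · exact key _ _ n2 n3 g.2
    · exact key _ _ n1 n3 g.2

theorem YVP {n : ℕ} {A : ZMod n → Pt} {P : Finset Pt} (hp : ∀ c : Pt, c ∈ P ↔ ∃ i, A i = c) :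
    Yset A ⊆ VP P := by
  rintro ⟨x, y⟩ h
  have key : ∀ a b c d : ℤ, NA A a b c d → (x = a ∨ x = a + 1) → (y = b ∨ y = b + 1) → (x, y) ∈ VP P := by
    rintro a b c d ⟨i, h1, -⟩ h3 h4
    simp only [VP, Set.mem_iUnion]
    exact ⟨(a, b), (hp _).2 ⟨i, h1⟩, (cv_iff _ _).2 ⟨h3, h4⟩⟩
  rcases h with h|h|h|h|h|h|h|h
  · exact key _ _ _ _ h.2.2 (by omega) (by omega)
  · exact key _ _ _ _ h.2.2 (by omega) (by omega)
  · exact key _ _ _ _ h.2.2 (by omega) (by omega)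
  · exact key _ _ _ _ h.2.2 (by omega) (by omega)
  · exact key _ _ _ _ h.2.2.2.2 (by omega) (by omega)
  · exact key _ _ _ _ h.2.2.2.2 (by omega) (by omega)
  · exact key _ _ _ _ h.2.2.2.2 (by omega) (by omega)
  · exact key _ _ _ _ h.2.2.2.2 (by omega) (by omega)



theorem anti_max {po : Pt → Pt → Prop} (tr : ∀ a b c, po a b → po b c → po a c)
    (tri : ∀ a b, po a b ∨ a = b ∨ po b a) {A B C D : Pt} (h1 : A ≠ C) (h2 : A ≠ D) (h3 : B ≠ C) (h4 : B ≠ D)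
    (h5 : C ≠ D) (h : ¬ ((po C B ∧ po D B) ∨ (po C A ∧ po D A))) :
    (po A C ∧ po B C) ∨ (po A D ∧ po B D) := by
  rcases tri C D with t | t | t
  · right
    constructor
    · rcases tri A D with u | u | u
      · exact u
      · exact (h2 u).elim
      · exact (h (.inr ⟨tr _ _ _ t u, u⟩)).elim
    · rcases tri B D with u | u | u
      · exact u
      · exact (h4 u).elim
      · exact (h (.inl ⟨tr _ _ _ t u, u⟩)).elim
  · exact (h5 t).elim
  · left
    constructor
    · rcases tri A C with u | u | u
      · exact u
      · exact (h1 u).elim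
      · exact (h (.inr ⟨u, tr _ _ _ t u⟩)).elim
    · rcases tri B C with u | u | u
      · exact u
      · exact (h3 u).elim
      · exact (h (.inl ⟨u, tr _ _ _ t u⟩)).elim

theorem led_mx {S : Sys} {po : Pt → Pt → Prop} (tr : ∀ a b c, po a b → po b c → po a c)
    (tri : ∀ a b, po a b ∨ a = b ∨ po b a) (hdg : S.dg = dgo po) {vx vy px py : ℤ} (h : Sys.Led S vx vy px py) :
    (po (vx, py) (vx, vy) ∧ po (px, vy) (vx, vy)) ∨ (po (vx, py) (px, py) ∧ po (px, vy) (px, py)) := by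
  obtain ⟨⟨n1, n2, -⟩, h⟩ := h
  unfold Sys.dgb at h
  rw [hdg] at h
  rcases lt_or_gt_of_ne n1 with c1 | c1 <;> rcases lt_or_gt_of_ne n2 with c2 | c2 <;>
    simp only [c1, c2, c1.le, c2.le, c1.not_gt, c2.not_gt, min_eq_left, min_eq_right, max_eq_left, max_eq_right, true_iff, iff_true,
      false_iff, iff_false, iff_self, not_true] at h
  · unfold dgo at h; tauto
  · have := anti_max tr tri (A := (vx, py)) (B := (px, vy)) (C := (vx, vy)) (D := (px, py)) (by simp; omega) (by simp; omega) (by simp; omega) (by simp; omega) (by simp; omega) h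
    tauto
  · have := anti_max tr tri (A := (px, vy)) (B := (vx, py)) (C := (px, py)) (D := (vx, vy)) (by simp; omega) (by simp; omega) (by simp; omega) (by simp; omega) (by simp; omega) h
    tauto
  · unfold dgo at h; tauto

def cvf (a : Pt) : Finset Pt := {a, (a.1 + 1, a.2), (a.1, a.2 + 1), (a.1 + 1, a.2 + 1)}

theorem corner_mem {S : Sys} {P : Finset Pt} (hP : ∀ a b, PD S.N a b ↔ (a, b) ∈ P) {vx vy px py : ℤ}
    (h : Sys.sq S vx vy px py) : (vx, vy) ∈ P.biUnion cvf := by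
  obtain ⟨n1, n2, h⟩ := h
  rw [Finset.mem_biUnion]
  rcases lt_or_gt_of_ne n1 with c1 | c1 <;> rcases lt_or_gt_of_ne n2 with c2 | c2
  · exact ⟨(vx, vy), (hP _ _).1 (h _ _ (by omega) (by omega) (by omega) (by omega)), by simp [cvf]⟩
  · exact ⟨(vx, vy - 1), (hP _ _).1 (h _ _ (by omega) (by omega) (by omega) (by omega)), by simp [cvf]⟩
  · exact ⟨(vx - 1, vy), (hP _ _).1 (h _ _ (by omega) (by omega) (by omega) (by omega)), by simp [cvf]⟩
  · exact ⟨(vx - 1, vy - 1), (hP _ _).1 (h _ _ (by omega) (by omega) (by omega) (by omega)), by simp [cvf]⟩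

theorem sq_swap {S : Sys} {a b c d : ℤ} (h : Sys.sq S a b c d) : Sys.sq S c d a b :=
  Sys.sq_of h h ⟨h.1.symm, h.2.1.symm⟩ (by intros; omega)

theorem sq_x {S : Sys} {a b c d : ℤ} (h : Sys.sq S a b c d) : Sys.sq S a d c b :=
  Sys.sq_of h h ⟨h.1, h.2.1.symm⟩ (by intros; omega)

theorem led_swap {S : Sys} {a b c d : ℤ} (h : Sys.Led S a b c d) : Sys.Led S c d a b := by
  refine ⟨sq_swap h.1, ?_⟩
  have h1 := h.1.1
  have h2 := h.1.2.1
  have := h.2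
  rw [Sys.dgb_x, Sys.dgb_y, ← this]
  omega

theorem led_tog {S : Sys} {a b c d : ℤ} (h : Sys.sq S a b c d) : Sys.Led S a b c d ∨ Sys.Led S a d c b := by
  have h1 := h.1
  have h2 := h.2.1
  by_cases cc : (a < c ↔ b < d) ↔ Sys.dgb S a b c d
  · exact .inl ⟨h, cc⟩
  · refine .inr ⟨sq_x h, ?_⟩
    rw [← Sys.dgb_y]
    have : (a < c ↔ d < b) ↔ ¬ (a < c ↔ b < d) := by omega
    rw [this]; tauto

open Classical in
noncomputable def rkf (P : Finset Pt) (po : Pt → Pt → Prop) (z : Pt) : ℕ :=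
  ((P.biUnion cvf).filter fun w => po w z).card

theorem rkf_lt {P : Finset Pt} {po : Pt → Pt → Prop} (irr : ∀ a, ¬ po a a)
    (tr : ∀ a b c, po a b → po b c → po a c) {w z : Pt} (hw : w ∈ P.biUnion cvf) (h : po w z) :
    rkf P po w < rkf P po z := by
  classical
  unfold rkf
  apply Finset.card_lt_card
  rw [Finset.ssubset_iff_of_subset]
  · exact ⟨w, Finset.mem_filter.2 ⟨hw, h⟩, fun h' => irr _ (Finset.mem_filter.1 h').2⟩
  · intro x hx
    rw [Finset.mem_filter] at hx ⊢
    exact ⟨hx.1, tr _ _ _ hx.2 h⟩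

noncomputable def mkRS (S : Sys) (P : Finset Pt) (po : Pt → Pt → Prop) (irr : ∀ a, ¬ po a a)
    (tr : ∀ a b c, po a b → po b c → po a c) (tri : ∀ a b, po a b ∨ a = b ∨ po b a)
    (hdg : S.dg = dgo po) (hP : ∀ a b, PD S.N a b ↔ (a, b) ∈ P) : RS where
  Sq v p := Sys.sq S v.1 v.2 p.1 p.2
  Ld v p := Sys.Led S v.1 v.2 p.1 p.2
  rk := rkf P po
  ldsq h := h.1
  ldsy h := led_swap h
  nex h := h.1
  ney h := h.2.1
  tog h := led_tog h
  mx := by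
    rintro ⟨vx, vy⟩ ⟨px, py⟩ h
    have m1 := corner_mem hP (sq_x h.1)
    have m2 := corner_mem hP (sq_swap (sq_x h.1))
    rcases led_mx tr tri hdg h with l | l
    · exact .inl ⟨rkf_lt irr tr m1 l.1, rkf_lt irr tr m2 l.2⟩
    · exact .inr ⟨rkf_lt irr tr m1 l.1, rkf_lt irr tr m2 l.2⟩
  sx := by
    rintro ⟨vx, vy⟩ ⟨px, py⟩ ⟨qx, qy⟩ h h' e n
    simp only at *
    subst e
    have := h.1.1
    exact Sys.sq_of h.1 h'.1 ⟨this, n⟩ (by intros; omega)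
  sy := by
    rintro ⟨vx, vy⟩ ⟨px, py⟩ ⟨qx, qy⟩ h h' e n
    simp only at *
    subst e
    have := h.1.2.1
    exact Sys.sq_of h.1 h'.1 ⟨n, this⟩ (by intros; omega)
  lc := by
    rintro ⟨vx, vy⟩ ⟨px, py⟩ ⟨qx, qy⟩ h h' e n
    exact Sys.LC h h' e n

noncomputable def mkGB (S : Sys) (P : Finset Pt) (po : Pt → Pt → Prop) (irr : ∀ a, ¬ po a a)
    (tr : ∀ a b c, po a b → po b c → po a c) (tri : ∀ a b, po a b ∨ a = b ∨ po b a)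
    (hdg : S.dg = dgo po) (hP : ∀ a b, PD S.N a b ↔ (a, b) ∈ P) : GBData P po where
  T := mkRS S P po irr tr tri hdg hP
  irr := irr
  tr := tr
  tri := tri
  hsq := by
    rintro ⟨a, b⟩ ⟨c, d⟩ ⟨h1, h2, h3⟩
    simp only at *
    refine ⟨h1.ne, h2.ne, fun m n g1 g2 g3 g4 => ?_⟩
    exact (hP _ _).2 (h3 (m, n) (by simp only at *; omega) (by simp only at *; omega) (by simp only at *; omega) (by simp only at *; omega))
  hsq' := by
    rintro ⟨vx, vy⟩ ⟨px, py⟩ h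
    obtain ⟨⟨n1, n2, h⟩, -⟩ := h
    simp only at *
    refine ⟨(min vx px, min vy py), (max vx px, max vy py), ⟨by simp only; omega, by simp only; omega, ?_⟩, ?_⟩
    · rintro ⟨m, n⟩ g1 g2 g3 g4
      exact (hP _ _).1 (h m n g1 g2 g3 g4)
    · rcases lt_or_gt_of_ne n1 with c1 | c1 <;> rcases lt_or_gt_of_ne n2 with c2 | c2 <;>
        simp only [c1.le, c2.le, min_eq_left, min_eq_right, max_eq_left, max_eq_right]
      · exact .inl ⟨trivial, trivial⟩
      · exact .inr ⟨trivial, trivial⟩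
      · exact .inr ⟨RS.m2c _ _, RS.m2c _ _⟩
      · exact .inl ⟨RS.m2c _ _, RS.m2c _ _⟩
  hmx := by
    rintro ⟨vx, vy⟩ ⟨px, py⟩ h
    exact led_mx tr tri hdg h

theorem exists_Y_reducedGB_of_WPentomino_and_RWHeptomino
    (K : Type*) [Field K] (P : Finset Pt) (hP : IsClosedPath P)
    (hW : ∃ a₁ a₂ A : Pt, IsWPentomino P a₁ a₂ A)
    (hRW : ∃ a₁ a₂ A : Pt, IsRWHeptomino P a₁ a₂ A) :
    ∃ Y : Set Pt, Y ⊆ VP P ∧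
      IsReducedGroebnerBasis (Ylt Y) (minorsSet K P) (polyoIdeal K P) := by
  obtain ⟨n, hn, A, hi, ha, hd, hp⟩ := hP
  refine ⟨Yset A, YVP hp, ?_⟩
  exact (mkGB (mkSys hn A hi ha hd) P (Ylt (Yset A)) (Ylt_irr _) (Ylt_tr _) (Ylt_tri _) rfl
    (fun a b => (PDA A a b).trans (hp _).symm)).main K

end ClosedPathPaper
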